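/- arXiv:1504.05759 — 2 statements merged into one kernel-verified Lean document; each statement's English description precedes it below -/
import Mathlib

section
/- Let 1<p<∞, let σ be a Radon measure on ℝ^N, and let (f_k)_{k∈ℤ} ∈ L^p(σ;ℓ²). Then for any l∈ℤ, ‖(f_k)_{k∈ℤ}‖_{L^p(σ;ℓ²)} is comparable, with constants depending only on p, to ‖(Σ_{k∈ℤ} Σ_{Q∈𝒟_l} (⟨f_k⟩^σ_Q)² 1_Q + Σ_{k∈ℤ} Σ_{Q∈𝒟, l(Q)≤2^{−l}} (Δ^σ_Q f_k)²)^{1/2}‖_{L^p(σ)} (a vector-valued Burkholder inequality). -/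
open MeasureTheory ENNReal Set

noncomputable section

abbrev EucN (N : ℕ) := Fin N → ℝ

/-- The half-open cube `x + [0, 2^{-k})^N`. -/
def dyCube (N : ℕ) (k : ℤ) (x : EucN N) : Set (EucN N) :=
  {y | ∀ i, x i ≤ y i ∧ y i < x i + (2 : ℝ) ^ (-k)}

/-- A dyadic lattice on `ℝ^N`: for every `k ∈ ℤ`, `gen k` is a partition of `ℝ^N` into
half-open cubes of side `2^{-k}`, and the generations are nested. -/
structure DyadicLattice (N : ℕ) where
  gen : ℤ → Set (Set (EucN N))
  cube_form : ∀ k Q, Q ∈ gen k → ∃ x, Q = dyCube N k x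
  covers : ∀ k (y : EucN N), ∃ Q ∈ gen k, y ∈ Q
  pairwiseDisjoint : ∀ k, (gen k).PairwiseDisjoint id
  nested : ∀ k, ∀ Q ∈ gen (k + 1), ∃ R ∈ gen k, Q ⊆ R

namespace DyadicLattice
variable {N : ℕ}
/-- The collection `𝒟` of all dyadic cubes. -/
def cubes (D : DyadicLattice N) : Set (Set (EucN N)) := ⋃ k, D.gen k
/-- `Q'` is a dyadic child of `Q`. -/
def child (D : DyadicLattice N) (Q Q' : Set (EucN N)) : Prop :=
  ∃ k, Q ∈ D.gen k ∧ Q' ∈ D.gen (k + 1) ∧ Q' ⊆ Q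
/-- `R = Q^{(r)}` is the `r`-th dyadic ancestor of `Q`. -/
def anc (D : DyadicLattice N) (r : ℕ) (Q R : Set (EucN N)) : Prop :=
  ∃ k : ℤ, Q ∈ D.gen k ∧ R ∈ D.gen (k - r) ∧ Q ⊆ R
end DyadicLattice

/-- `ℝ≥0∞`-valued indicator of a set. -/
def indE {N : ℕ} (Q : Set (EucN N)) (x : EucN N) : ℝ≥0∞ := Q.indicator 1 x

/-- `‖ (∑ i (f i)²)^{1/2} ‖_{L^p(μ)}` for a family of `ℝ≥0∞`-valued functions. -/
def sqNorm {N : ℕ} {ι : Type*} (μ : Measure (EucN N)) (p : ℝ)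
    (f : ι → EucN N → ℝ≥0∞) : ℝ≥0∞ :=
  (∫⁻ x, (∑' i, f i x ^ 2) ^ (p / 2) ∂μ) ^ (1 / p)

/-- The quadratic `𝒜_{p,q}` constant `[σ,w]_{p,q}`: the least `C` such that for all real
coefficients `(a_Q)_{Q ∈ 𝒟}`,
`‖(∑_Q (a_Q σ(Q)/|Q|)² 1_Q)^{1/2}‖_{L^q(w)} ≤ C ‖(∑_Q a_Q² 1_Q)^{1/2}‖_{L^p(σ)}`. -/
def sqA {N : ℕ} (D : DyadicLattice N) (σ w : Measure (EucN N)) (p q : ℝ) : ℝ≥0∞ :=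
  sInf {C | ∀ a : Set (EucN N) → ℝ,
    sqNorm w q (fun Q : D.cubes => fun x =>
      (‖a (Q : Set (EucN N))‖₊ : ℝ≥0∞) * σ (Q : Set (EucN N)) / volume (Q : Set (EucN N))
        * indE (Q : Set (EucN N)) x)
    ≤ C * sqNorm σ p (fun Q : D.cubes => fun x =>
      (‖a (Q : Set (EucN N))‖₊ : ℝ≥0∞) * indE (Q : Set (EucN N)) x)}

/-- The average `⟨f⟩^σ_Q = σ(Q)^{-1} ∫_Q f dσ` (interpreted as `0` when `σ(Q) = 0`). -/
def avgM {N : ℕ} (σ : Measure (EucN N)) (Q : Set (EucN N)) (f : EucN N → ℝ) : ℝ :=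
  (∫ y in Q, f y ∂σ) / (σ Q).toReal

/-- The martingale difference
`Δ^σ_Q f = ∑_{Q' ∈ ch(Q)} ⟨f⟩^σ_{Q'} 1_{Q'} − ⟨f⟩^σ_Q 1_Q`. -/
def mdiffS {N : ℕ} (D : DyadicLattice N) (σ : Measure (EucN N)) (f : EucN N → ℝ)
    (Q : Set (EucN N)) (x : EucN N) : ℝ :=
  (∑' Q' : {R // D.child Q R},
      (Q' : Set (EucN N)).indicator (fun _ => avgM σ (Q' : Set (EucN N)) f) x)
    - Q.indicator (fun _ => avgM σ Q f) x

/-- Tangent line inequality for the convex function `t ↦ t ^ q`, `1 ≤ q`. -/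
theorem rpow_tangent_le {q a b : ℝ} (hq : 1 ≤ q) (ha : 0 ≤ a) (hb : 0 ≤ b) :
    a ^ q + q * a ^ (q - 1) * (b - a) ≤ b ^ q := by
  rcases ha.eq_or_lt with rfl | ha
  · rcases hq.eq_or_lt with rfl | hq
    · simp
    · rw [Real.zero_rpow (by linarith), Real.zero_rpow (by linarith)]
      simpa using Real.rpow_nonneg hb q
  · have h := one_add_mul_self_le_rpow_one_add (s := b / a - 1)
      (by linarith [div_nonneg hb ha.le]) hq
    rw [add_sub_cancel, Real.div_rpow hb ha.le, le_div_iff₀ (by positivity)] at h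
    rw [Real.rpow_sub_one ha.ne']
    calc _ = (1 + q * (b / a - 1)) * a ^ q := by field_simp
      _ ≤ _ := h

/-- Tangent line inequality for the concave function `t ↦ t ^ q`, `0 ≤ q ≤ 1`. -/
theorem le_rpow_tangent {q a b : ℝ} (hq₀ : 0 ≤ q) (hq : q ≤ 1) (ha : 0 < a) (hb : 0 ≤ b) :
    b ^ q ≤ a ^ q + q * a ^ (q - 1) * (b - a) := by
  have h := rpow_one_add_le_one_add_mul_self (s := b / a - 1)
      (by linarith [div_nonneg hb ha.le]) hq₀ hq
  rw [add_sub_cancel, Real.div_rpow hb ha.le, div_le_iff₀ (by positivity)] at h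
  rw [Real.rpow_sub_one ha.ne']
  calc _ ≤ (1 + q * (b / a - 1)) * a ^ q := h
    _ = _ := by field_simp

/-- The scalar data `r = ‖x‖`, `r' = ‖x + d‖`, `δ = ‖d‖`, `τ = ⟪x, d⟫` of an increment
`x ↦ x + d` in an inner product space. -/
structure IsIncrement (r r' δ τ : ℝ) : Prop where
  left_nonneg : 0 ≤ r
  right_nonneg : 0 ≤ r'
  norm_nonneg : 0 ≤ δ
  sq_eq : r' ^ 2 = r ^ 2 + 2 * τ + δ ^ 2
  abs_inner_le : |τ| ≤ r * δ

namespace IsIncrement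

variable {r r' δ τ : ℝ}

theorem abs_add_sq_le (h : IsIncrement r r' δ τ) : |τ + δ ^ 2| ≤ r' * δ := by
  have := h.right_nonneg
  have := h.norm_nonneg
  refine abs_le_of_sq_le_sq ?_ (by positivity)
  have h1 : τ ^ 2 ≤ (r * δ) ^ 2 := by
    rw [← sq_abs τ]; exact pow_le_pow_left₀ (abs_nonneg _) h.abs_inner_le 2
  rw [mul_pow, h.sq_eq]
  nlinarith

theorem symm (h : IsIncrement r r' δ τ) : IsIncrement r' r δ (-(τ + δ ^ 2)) :=
  ⟨h.right_nonneg, h.left_nonneg, h.norm_nonneg, by linarith [h.sq_eq],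
    by rw [abs_neg]; exact h.abs_add_sq_le⟩

theorem right_le (h : IsIncrement r r' δ τ) : r' ≤ r + δ := by
  have := h.left_nonneg
  have := h.norm_nonneg
  have := (abs_le.1 h.abs_inner_le).2
  refine le_of_sq_le_sq ?_ (by positivity)
  nlinarith [h.sq_eq]

theorem left_le (h : IsIncrement r r' δ τ) : r ≤ r' + δ := h.symm.right_le

theorem norm_le (h : IsIncrement r r' δ τ) : δ ≤ r + r' := by
  have h1 := h.left_nonneg
  have h2 := h.right_nonneg
  have := (abs_le.1 h.abs_add_sq_le).1
  have := (abs_le.1 h.abs_inner_le).1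
  have := (abs_le.1 h.abs_add_sq_le).2
  rcases h.norm_nonneg.eq_or_lt with h0 | h0
  · linarith
  · nlinarith

theorem sq_sub_le (h : IsIncrement r r' δ τ) : (r' - r) ^ 2 ≤ δ ^ 2 :=
  sq_le_sq' (by linarith [h.left_le]) (by linarith [h.right_le])

theorem exists_midpoint (h : IsIncrement r r' δ τ) :
    ∃ m, IsIncrement r m (δ / 2) (τ / 2) ∧ IsIncrement m r' (δ / 2) (τ / 2 + (δ / 2) ^ 2) := by
  have hr := h.left_nonneg
  have hδ := h.norm_nonneg
  have hτ := abs_le.1 h.abs_inner_le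
  have hm : 0 ≤ r ^ 2 + τ + δ ^ 2 / 4 := by nlinarith [sq_nonneg (r - δ / 2)]
  have h1 : IsIncrement r (√(r ^ 2 + τ + δ ^ 2 / 4)) (δ / 2) (τ / 2) :=
    ⟨hr, Real.sqrt_nonneg _, by positivity, by rw [Real.sq_sqrt hm]; ring,
      by rw [abs_le]; constructor <;> linarith⟩
  exact ⟨_, h1, h1.right_nonneg, h.right_nonneg, h1.norm_nonneg,
    by rw [Real.sq_sqrt hm, h.sq_eq]; ring, h1.abs_add_sq_le⟩

theorem rpow_tangent_le {p : ℝ} (hp : 1 ≤ p) (h : IsIncrement r r' δ τ) :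
    r ^ p + p * r ^ (p - 2) * τ ≤ r' ^ p := by
  have h1 := _root_.rpow_tangent_le hp h.left_nonneg h.right_nonneg
  have h2 := h.symm
  rcases h.left_nonneg.eq_or_lt with hr | hr
  · have hτ : τ = 0 := by simpa [← hr] using h.abs_inner_le
    rw [← hr, hτ, Real.zero_rpow (by linarith)]
    simpa using Real.rpow_nonneg h.right_nonneg p
  · refine le_trans ?_ h1
    have h3 : r ^ (p - 1) = r ^ (p - 2) * r := by
      rw [← Real.rpow_add_one hr.ne']; ring_nf
    have h4 : r ^ 2 + τ ≤ r * r' := by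
      have := h.left_nonneg
      have := h.right_nonneg
      have h5 : τ ^ 2 ≤ (r * δ) ^ 2 := by
        rw [← sq_abs τ]; exact pow_le_pow_left₀ (abs_nonneg _) h.abs_inner_le 2
      refine (abs_le_of_sq_le_sq' ?_ (by positivity)).2
      rw [mul_pow, h.sq_eq]
      nlinarith
    rw [h3]
    have : 0 ≤ p * r ^ (p - 2) := by positivity
    nlinarith

/-- The defect of monotonicity of `x ↦ ‖x‖ ^ k • x`, in scalar form. -/
theorem rpow_mul_sub_eq (k : ℝ) (h : IsIncrement r r' δ τ) :
    r' ^ k * (τ + δ ^ 2) - r ^ k * τ =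
      ((r' ^ k - r ^ k) * (r' ^ 2 - r ^ 2) + (r' ^ k + r ^ k) * δ ^ 2) / 2 := by
  rw [h.sq_eq]; ring

/-- A second order lower bound for `‖x + d‖ ^ p`, through the midpoint. -/
theorem exists_midpoint_rpow_le {p : ℝ} (hp : 1 ≤ p) (h : IsIncrement r r' δ τ) :
    ∃ m t, IsIncrement r m (δ / 2) t ∧
      r ^ p + p * r ^ (p - 2) * τ +
        p * (m ^ (p - 2) * (t + (δ / 2) ^ 2) - r ^ (p - 2) * t) ≤ r' ^ p := by
  obtain ⟨m, h1, h2⟩ := h.exists_midpoint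
  refine ⟨m, τ / 2, h1, ?_⟩
  have h3 := h1.rpow_tangent_le hp
  have h4 := h2.rpow_tangent_le hp
  linarith

/-- For `p ≥ 2`: `‖x + d‖ ^ p ≥ ‖x‖ ^ p + p ‖x‖ ^ (p - 2) ⟪x, d⟫ + c ‖d‖ ^ p`. -/
theorem rpow_add_le_of_two_le {p : ℝ} (hp : 2 ≤ p) (h : IsIncrement r r' δ τ) :
    r ^ p + p * r ^ (p - 2) * τ + (1 / 4) ^ p * δ ^ p ≤ r' ^ p := by
  obtain ⟨m, t, hm, h1⟩ := h.exists_midpoint_rpow_le (by linarith : 1 ≤ p)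
  refine le_trans ?_ h1
  have hδ := h.norm_nonneg
  have hr := h.left_nonneg
  have hm0 := hm.right_nonneg
  rw [hm.rpow_mul_sub_eq]
  have e1 : 0 ≤ (m ^ (p - 2) - r ^ (p - 2)) * (m ^ 2 - r ^ 2) := by
    rcases le_total m r with hle | hle
    · exact mul_nonneg_of_nonpos_of_nonpos
        (by linarith [Real.rpow_le_rpow hm0 hle (by linarith : 0 ≤ p - 2)])
        (by nlinarith)
    · exact mul_nonneg (by linarith [Real.rpow_le_rpow hr hle (by linarith : 0 ≤ p - 2)])
        (by nlinarith)
  have e2 : (δ / 4) ^ (p - 2) ≤ m ^ (p - 2) + r ^ (p - 2) := by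
    have hmr := hm.norm_le
    have := Real.rpow_nonneg hm0 (p - 2)
    have := Real.rpow_nonneg hr (p - 2)
    rcases le_total m r with hle | hle
    · linarith [Real.rpow_le_rpow (by positivity : 0 ≤ δ / 4) (by linarith : δ / 4 ≤ r)
        (by linarith : 0 ≤ p - 2)]
    · linarith [Real.rpow_le_rpow (by positivity : 0 ≤ δ / 4) (by linarith : δ / 4 ≤ m)
        (by linarith : 0 ≤ p - 2)]
  have e3 : (1 / 4) ^ p * δ ^ p = (δ / 4) ^ (p - 2) * (δ / 4) ^ 2 := by
    rw [← Real.mul_rpow (by norm_num) hδ, ← Real.rpow_two (δ / 4),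
      ← Real.rpow_add_of_nonneg (by positivity) (by linarith) (by norm_num)]
    ring_nf
  rw [e3]
  have e4 := mul_le_mul_of_nonneg_right e2 (sq_nonneg δ)
  have e5 : 0 ≤ (δ / 4) ^ (p - 2) * δ ^ 2 := by positivity
  nlinarith

/-- For `1 < p ≤ 2`:
`‖x + d‖ ^ p ≥ ‖x‖ ^ p + p ‖x‖ ^ (p - 2) ⟪x, d⟫ + c ‖d‖ ^ 2 (‖x‖ + ‖d‖) ^ (p - 2)`. -/
theorem rpow_add_le_of_le_two {p : ℝ} (hp : 1 < p) (hp2 : p ≤ 2) (h : IsIncrement r r' δ τ)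
    (hδ : 0 < δ) :
    r ^ p + p * r ^ (p - 2) * τ + (p - 1) / 4 * (δ ^ 2 * (r + δ) ^ (p - 2)) ≤ r' ^ p := by
  obtain ⟨m, t, hm, h1⟩ := h.exists_midpoint_rpow_le hp.le
  refine le_trans ?_ h1
  have hr := h.left_nonneg
  have hm0 := hm.right_nonneg
  have key : ∀ R : ℝ, 0 < R → m ≤ R → r ≤ R → (p - 1) * R ^ (p - 2) * (δ / 2) ^ 2 ≤
      m ^ (p - 2) * (t + (δ / 2) ^ 2) - r ^ (p - 2) * t := by
    intro R hR hmR hrR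
    have hanti : ∀ a, 0 < a → a ≤ R → R ^ (p - 2) ≤ a ^ (p - 2) := fun a ha haR =>
      Real.rpow_le_rpow_of_nonpos ha haR (by linarith)
    rcases hr.eq_or_lt with hr0 | hr0
    · have ht : t = 0 := by simpa [← hr0] using hm.abs_inner_le
      have hmη : m = δ / 2 := by
        have := hm.sq_eq
        rw [ht, ← hr0] at this
        exact (pow_left_inj₀ hm0 (by positivity) two_ne_zero).1 (by linarith)
      have h2 := hanti m (by rw [hmη]; positivity) hmR
      have h3 : 0 ≤ R ^ (p - 2) := by positivity
      rw [ht]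
      have h4 : (p - 1) * R ^ (p - 2) ≤ m ^ (p - 2) := by nlinarith
      nlinarith [mul_le_mul_of_nonneg_right h4 (sq_nonneg (δ / 2))]
    rcases hm0.eq_or_lt with hm1 | hm1
    · have ht : t + (δ / 2) ^ 2 = 0 := by simpa [← hm1] using hm.abs_add_sq_le
      have h2 := hanti r hr0 hrR
      have h3 : 0 ≤ R ^ (p - 2) := by positivity
      have h4 : (p - 1) * R ^ (p - 2) ≤ r ^ (p - 2) := by nlinarith
      have ht' : t = -(δ / 2) ^ 2 := by linarith
      rw [ht, ht']
      nlinarith [mul_le_mul_of_nonneg_right h4 (sq_nonneg (δ / 2))]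
    have a1 := hanti r hr0 hrR
    have a2 := hanti m hm1 hmR
    have hR0 : 0 ≤ R ^ (p - 2) := by positivity
    have b1 : ∀ a b : ℝ, 0 < a → 0 < b → b ≤ a → a ≤ R →
        (p - 1) * R ^ (p - 2) * (a - b) ≤ a ^ (p - 1) - b ^ (p - 1) := by
      intro a b ha hb hab haR
      have h2 := le_rpow_tangent (by linarith : 0 ≤ p - 1) (by linarith) ha hb.le
      rw [show p - 1 - 1 = p - 2 by ring] at h2
      have h3 := hanti a ha haR
      have h4 : (p - 1) * R ^ (p - 2) * (a - b) ≤ (p - 1) * a ^ (p - 2) * (a - b) := by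
        have : 0 ≤ p - 1 := by linarith
        have : 0 ≤ a - b := by linarith
        gcongr
      linarith
    have b2 : (p - 1) * R ^ (p - 2) * (m - r) ^ 2 ≤
        (m ^ (p - 1) - r ^ (p - 1)) * (m - r) := by
      rcases le_total m r with hle | hle
      · have := mul_le_mul_of_nonneg_right (b1 r m hr0 hm1 hle hrR) (by linarith : 0 ≤ r - m)
        linarith
      · have := mul_le_mul_of_nonneg_right (b1 m r hm1 hr0 hle hmR) (by linarith : 0 ≤ m - r)
        linarith
    have c1 : ∀ a : ℝ, 0 < a → a ^ (p - 1) = a ^ (p - 2) * a := fun a ha => by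
      rw [← Real.rpow_add_one ha.ne']; ring_nf
    rw [c1 m hm1, c1 r hr0] at b2
    rw [hm.rpow_mul_sub_eq]
    have c2 := hm.sq_sub_le
    have c3 : (p - 1) * R ^ (p - 2) ≤ R ^ (p - 2) := by nlinarith
    nlinarith [mul_nonneg (by linarith : 0 ≤ (m ^ (p - 2) + r ^ (p - 2)) / 2 -
      (p - 1) * R ^ (p - 2)) (by linarith : 0 ≤ (δ / 2) ^ 2 - (m - r) ^ 2)]
  have h2 := key (r + δ) (by linarith) (by linarith [hm.right_le]) (by linarith)
  have h3 : 0 ≤ (p - 1) * (r + δ) ^ (p - 2) * (δ / 2) ^ 2 := by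
    have : 0 ≤ p - 1 := by linarith
    positivity
  nlinarith

/-- For `p ≥ 2`:
`‖x + d‖ ^ p ≤ ‖x‖ ^ p + p ‖x‖ ^ (p - 2) ⟪x, d⟫ + C (‖x‖ + ‖d‖) ^ (p - 2) ‖d‖ ^ 2`. -/
theorem rpow_le_of_two_le {p : ℝ} (hp : 2 ≤ p) (h : IsIncrement r r' δ τ) :
    r' ^ p ≤ r ^ p + p * r ^ (p - 2) * τ + p ^ 2 * ((r + δ) ^ (p - 2) * δ ^ 2) := by
  have hr := h.left_nonneg
  have hr' := h.right_nonneg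
  have hδ := h.norm_nonneg
  have h1 := h.symm.rpow_tangent_le (by linarith : 1 ≤ p)
  have h2 := h.rpow_mul_sub_eq (p - 2)
  have hR : 0 ≤ (r + δ) ^ (p - 2) := by positivity
  have key : ∀ a b : ℝ, 0 ≤ b → b ≤ a → a ≤ r + δ →
      (a ^ (p - 2) - b ^ (p - 2)) * (a ^ 2 - b ^ 2) ≤
        2 * (p - 1) * (r + δ) ^ (p - 2) * (a - b) ^ 2 := by
    intro a b hb hab haR
    have ha := hb.trans hab
    have e1 := _root_.rpow_tangent_le (by linarith : 1 ≤ p - 1) ha hb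
    rw [show p - 1 - 1 = p - 2 by ring] at e1
    have c1 : ∀ a : ℝ, 0 ≤ a → a ^ (p - 1) = a ^ (p - 2) * a := fun a ha => by
      rcases hp.eq_or_lt with rfl | hp
      · norm_num
      rw [← Real.rpow_add_one' ha (by linarith)]; ring_nf
    rw [c1 a ha, c1 b hb] at e1
    have e2 : a ^ (p - 2) ≤ (r + δ) ^ (p - 2) := Real.rpow_le_rpow ha haR (by linarith)
    have e3 : b ^ (p - 2) ≤ a ^ (p - 2) := Real.rpow_le_rpow hb hab (by linarith)
    have e4 : 0 ≤ b ^ (p - 2) := by positivity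
    have hab' : 0 ≤ a - b := by linarith
    calc _ = ((a ^ (p - 2) - b ^ (p - 2)) * (a + b)) * (a - b) := by ring
      _ ≤ (2 * ((p - 1) * a ^ (p - 2) * (a - b))) * (a - b) := by
        refine mul_le_mul_of_nonneg_right ?_ hab'
        nlinarith
      _ ≤ (2 * ((p - 1) * (r + δ) ^ (p - 2) * (a - b))) * (a - b) := by
        have : 0 ≤ p - 1 := by linarith
        gcongr
      _ = _ := by ring
  have h3 : (r' ^ (p - 2) - r ^ (p - 2)) * (r' ^ 2 - r ^ 2) ≤
        2 * (p - 1) * (r + δ) ^ (p - 2) * (r' - r) ^ 2 := by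
    rcases le_total r r' with hle | hle
    · exact key r' r hr hle h.right_le
    · have := key r r' hr' hle (by linarith)
      linarith
  have h4 : 2 * (p - 1) * (r + δ) ^ (p - 2) * (r' - r) ^ 2 ≤
      2 * (p - 1) * (r + δ) ^ (p - 2) * δ ^ 2 :=
    mul_le_mul_of_nonneg_left h.sq_sub_le
      (mul_nonneg (by linarith) hR)
  have h5 : r' ^ (p - 2) ≤ (r + δ) ^ (p - 2) := Real.rpow_le_rpow hr' h.right_le (by linarith)
  have h6 : r ^ (p - 2) ≤ (r + δ) ^ (p - 2) := Real.rpow_le_rpow hr (by linarith) (by linarith)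
  have h7 : r' ^ (p - 2) * (τ + δ ^ 2) - r ^ (p - 2) * τ ≤ p * ((r + δ) ^ (p - 2) * δ ^ 2) := by
    rw [h2]
    have := mul_le_mul_of_nonneg_right (add_le_add h5 h6) (sq_nonneg δ)
    linarith
  nlinarith [mul_le_mul_of_nonneg_left h7 (by linarith : 0 ≤ p)]

end IsIncrement

theorem add_rpow_le_two_rpow_mul {a b e : ℝ} (ha : 0 ≤ a) (hb : 0 ≤ b) (he : 0 ≤ e) :
    (a + b) ^ e ≤ 2 ^ e * (a ^ e + b ^ e) := by
  have h1 : (a + b) ^ e ≤ (2 * max a b) ^ e :=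
    Real.rpow_le_rpow (by positivity)
      (by linarith [le_max_left a b, le_max_right a b]) he
  rw [Real.mul_rpow (by norm_num) (by positivity)] at h1
  refine h1.trans (mul_le_mul_of_nonneg_left ?_ (by positivity))
  have := Real.rpow_nonneg ha e
  have := Real.rpow_nonneg hb e
  rcases max_choice a b with h | h <;> rw [h] <;> linarith

/-- `U (‖x‖) s` is a Bellman function for pairs (martingale, squared square function) of growth
`p`: along an increment `x ↦ x + d`, `s ↦ s + ‖d‖ ^ 2` it grows by at most the linear term
`a (‖x‖) s * ⟪x, d⟫`. -/
structure IsBellman (p : ℝ) (U a : ℝ → ℝ → ℝ) : Prop where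
  measurable_left : Measurable (Function.uncurry U)
  measurable_right : Measurable (Function.uncurry a)
  zero_le : U 0 0 ≤ 0
  step_of_pos : ∀ {r r' δ τ s : ℝ}, IsIncrement r r' δ τ → 0 < δ → 0 ≤ s →
    U r' (s + δ ^ 2) ≤ U r s + a r s * τ
  growth : ∃ K, 0 ≤ K ∧ ∀ r s : ℝ, 0 ≤ r → 0 ≤ s →
    |U r s| ≤ K * (r ^ 2 + s) ^ (p / 2) ∧ |a r s| * r ≤ K * (r ^ 2 + s) ^ ((p - 1) / 2)

theorem IsBellman.step {p : ℝ} {U a : ℝ → ℝ → ℝ} (h : IsBellman p U a) {r r' δ τ s : ℝ}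
    (hi : IsIncrement r r' δ τ) (hs : 0 ≤ s) : U r' (s + δ ^ 2) ≤ U r s + a r s * τ := by
  rcases hi.norm_nonneg.eq_or_lt with h0 | h0
  · have hτ : τ = 0 := by simpa [← h0] using hi.abs_inner_le
    have hr : r' = r := le_antisymm (by linarith [hi.right_le]) (by linarith [hi.left_le])
    simp [← h0, hτ, hr]
  · exact h.step_of_pos hi h0 hs

theorem IsBellman.apply_sq_le {p : ℝ} {U a : ℝ → ℝ → ℝ} (h : IsBellman p U a) {r : ℝ}
    (hr : 0 ≤ r) : U r (r ^ 2) ≤ 0 := by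
  have hi : IsIncrement 0 r r 0 := ⟨le_rfl, hr, hr, by simp, by simp⟩
  have := h.step hi le_rfl
  simp only [zero_add, mul_zero, add_zero] at this
  exact this.trans h.zero_le

theorem sq_rpow_half {r : ℝ} (hr : 0 ≤ r) (e : ℝ) : (r ^ 2) ^ (e / 2) = r ^ e := by
  rw [← Real.rpow_natCast_mul hr]; congr 1; push_cast; ring

theorem rpow_le_sq_add_rpow {r s e : ℝ} (hr : 0 ≤ r) (hs : 0 ≤ s) (he : 0 ≤ e) :
    r ^ e ≤ (r ^ 2 + s) ^ (e / 2) := by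
  rw [← sq_rpow_half hr]
  exact Real.rpow_le_rpow (by positivity) (by linarith) (by positivity)

theorem sq_add_rpow_mul_le {r s e : ℝ} (hr : 0 ≤ r) (hs : 0 ≤ s) :
    (r ^ 2 + s) ^ (e / 2 - 1) * r ≤ (r ^ 2 + s) ^ ((e - 1) / 2) := by
  rcases hr.eq_or_lt with h0 | h0
  · rw [← h0]; simp; positivity
  have h1 : r ≤ (r ^ 2 + s) ^ (1 / 2 : ℝ) := by
    simpa using rpow_le_sq_add_rpow hr hs zero_le_one
  calc _ ≤ (r ^ 2 + s) ^ (e / 2 - 1) * (r ^ 2 + s) ^ (1 / 2 : ℝ) := by gcongr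
    _ = _ := by rw [← Real.rpow_add (by positivity)]; ring_nf

theorem rpow_sub_two_mul_le {r s e : ℝ} (hr : 0 ≤ r) (hs : 0 ≤ s) (he : 1 < e) :
    r ^ (e - 2) * r ≤ (r ^ 2 + s) ^ ((e - 1) / 2) := by
  refine le_trans (le_of_eq ?_) (rpow_le_sq_add_rpow hr hs (by linarith : 0 ≤ e - 1))
  rcases hr.eq_or_lt with h0 | h0
  · rw [← h0, Real.zero_rpow (by linarith : e - 1 ≠ 0)]; simp
  · rw [← Real.rpow_add_one h0.ne']; ring_nf

theorem half_rpow_le {g h p : ℝ} (hp : 1 < p) (hp2 : p ≤ 2) (hh : 0 < h) (hg : 0 ≤ g)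
    (hgh : g ≤ h) : h ^ (p - 2) ≤ 2 * (g + h) ^ (p - 2) := by
  have h1 : (2 * h) ^ (p - 2) ≤ (g + h) ^ (p - 2) :=
    Real.rpow_le_rpow_of_nonpos (by positivity) (by linarith) (by linarith)
  rw [Real.mul_rpow (by norm_num) hh.le] at h1
  have h2 : (1 / 2 : ℝ) ≤ 2 ^ (p - 2) := by
    rw [show (1 / 2 : ℝ) = 2 ^ (-1 : ℝ) by rw [Real.rpow_neg_one]; norm_num]
    exact Real.rpow_le_rpow_of_exponent_le (by norm_num) (by linarith)
  have : 0 ≤ h ^ (p - 2) := by positivity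
  nlinarith

theorem IsIncrement.sq_add_rpow_le {r r' δ τ s p : ℝ} (hp : 1 < p) (hp2 : p ≤ 2)
    (h : IsIncrement r r' δ τ) (hδ : 0 < δ) (hs : 0 ≤ s) :
    (r' ^ 2 + (s + δ ^ 2)) ^ (p / 2) ≤ (r ^ 2 + s) ^ (p / 2) + p * (r ^ 2 + s) ^ (p / 2 - 1) * τ
      + 14 * (δ ^ 2 * (√(r ^ 2 + s) + δ) ^ (p - 2)) := by
  have hr := h.left_nonneg
  obtain ⟨g, hg⟩ : ∃ g, g = √(r ^ 2 + s) := ⟨_, rfl⟩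
  have hg0 : 0 ≤ g := hg ▸ Real.sqrt_nonneg _
  have hgs : r ^ 2 + s = g ^ 2 := by rw [hg, Real.sq_sqrt (by positivity)]
  have hrg : r ≤ g := by rw [hg]; exact Real.le_sqrt_of_sq_le (by linarith)
  have hτ := abs_le.1 h.abs_inner_le
  rw [← hg, show r' ^ 2 + (s + δ ^ 2) = g ^ 2 + 2 * τ + 2 * δ ^ 2 by rw [h.sq_eq]; linarith, hgs,
    show p / 2 - 1 = (p - 2) / 2 by ring, sq_rpow_half hg0, sq_rpow_half hg0]
  have hE : 0 ≤ g ^ 2 + 2 * τ + 2 * δ ^ 2 := by nlinarith [sq_nonneg (r - δ), mul_self_le_mul_self hr hrg]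
  rcases le_or_gt δ g with hle | hlt
  · have hg1 : 0 < g := by linarith
    have h1 := le_rpow_tangent (by linarith : 0 ≤ p / 2) (by linarith) (by positivity : 0 < g ^ 2) hE
    rw [show p / 2 - 1 = (p - 2) / 2 by ring, sq_rpow_half hg0, sq_rpow_half hg0] at h1
    have h2 := half_rpow_le hp hp2 hg1 hδ.le hle
    rw [add_comm δ] at h2
    have h3 := mul_le_mul_of_nonneg_right h2 (sq_nonneg δ)
    have h4 : 0 ≤ (g + δ) ^ (p - 2) * δ ^ 2 := by positivity
    nlinarith
  · have h1 : (g ^ 2 + 2 * τ + 2 * δ ^ 2) ^ (p / 2) ≤ (5 * δ ^ 2) ^ (p / 2) :=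
      Real.rpow_le_rpow hE (by nlinarith) (by linarith)
    rw [Real.mul_rpow (by norm_num) (by positivity), sq_rpow_half hδ.le] at h1
    have h2 : (5 : ℝ) ^ (p / 2) ≤ 5 := by
      conv_rhs => rw [← Real.rpow_one 5]
      exact Real.rpow_le_rpow_of_exponent_le (by norm_num) (by linarith)
    have h3 : g ^ (p - 2) * r ≤ δ ^ (p - 1) := by
      calc _ ≤ g ^ (p - 2) * g := by gcongr
        _ ≤ g ^ (p - 1) := by
          rcases hg0.eq_or_lt with h0 | h0
          · rw [← h0]; simp; positivity
          · rw [← Real.rpow_add_one h0.ne']; ring_nf; rfl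
        _ ≤ _ := Real.rpow_le_rpow hg0 hlt.le (by linarith)
    have h4 : δ ^ p = δ ^ (p - 2) * δ ^ 2 := by
      rw [← Real.rpow_two, ← Real.rpow_add hδ]; ring_nf
    have h4' : δ ^ (p - 1) * δ = δ ^ p := by
      rw [← Real.rpow_add_one hδ.ne']; ring_nf
    have h5 := half_rpow_le hp hp2 hδ hg0 hlt.le
    have h6 := mul_le_mul_of_nonneg_right h5 (sq_nonneg δ)
    have h7 : -δ ^ p ≤ g ^ (p - 2) * τ := by
      have : 0 ≤ g ^ (p - 2) := by positivity
      nlinarith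
    have h8 : 0 ≤ g ^ p := by positivity
    have h9 : 0 ≤ δ ^ p := by positivity
    nlinarith

theorem isBellman_sq_of_le_two {p : ℝ} (hp : 1 < p) (hp2 : p ≤ 2) :
    IsBellman p (fun r s => (r ^ 2 + s) ^ (p / 2) - (56 / (p - 1) + 2) * r ^ p)
      (fun r s => p * (r ^ 2 + s) ^ (p / 2 - 1) - (56 / (p - 1) + 2) * (p * r ^ (p - 2))) where
  measurable_left := by unfold Function.uncurry; fun_prop
  measurable_right := by unfold Function.uncurry; fun_prop
  zero_le := by
    simp [Real.zero_rpow (by linarith : p / 2 ≠ 0), Real.zero_rpow (by linarith : p ≠ 0)]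
  step_of_pos {r r' δ τ s} h hδ hs := by
    have h1 := h.sq_add_rpow_le hp hp2 hδ hs
    have h2 := h.rpow_add_le_of_le_two hp hp2 hδ
    have hr := h.left_nonneg
    have h3 : (√(r ^ 2 + s) + δ) ^ (p - 2) ≤ (r + δ) ^ (p - 2) :=
      Real.rpow_le_rpow_of_nonpos (by positivity)
        (by linarith [Real.le_sqrt_of_sq_le (by linarith : r ^ 2 ≤ r ^ 2 + s)]) (by linarith)
    have h4 := mul_le_mul_of_nonneg_left h3 (sq_nonneg δ)
    have hp1 : 0 < p - 1 := by linarith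
    have h5 : 0 ≤ δ ^ 2 * (r + δ) ^ (p - 2) := by positivity
    have h6 : 14 * (δ ^ 2 * (r + δ) ^ (p - 2)) ≤
        (56 / (p - 1) + 2) * ((p - 1) / 4 * (δ ^ 2 * (r + δ) ^ (p - 2))) := by
      rw [← mul_assoc (56 / (p - 1) + 2)]
      refine mul_le_mul_of_nonneg_right ?_ h5
      rw [add_mul, show 56 / (p - 1) * ((p - 1) / 4) = 14 by field_simp; norm_num]
      linarith
    have h7 := mul_le_mul_of_nonneg_left h2 (by positivity : 0 ≤ 56 / (p - 1) + 2)
    linarith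
  growth := by
    have hp1 : 0 < p - 1 := by linarith
    set C := 56 / (p - 1) + 2 with hC
    have hC0 : 0 ≤ C := by positivity
    refine ⟨p * (1 + C), by positivity, fun r s hr hs => ⟨?_, ?_⟩⟩
    · have h1 := rpow_le_sq_add_rpow hr hs (by linarith : 0 ≤ p)
      have h2 : 0 ≤ r ^ p := by positivity
      have h3 := mul_le_mul_of_nonneg_left h1 hC0
      have h4 : 0 ≤ (r ^ 2 + s) ^ (p / 2) := by positivity
      have h5 : 0 ≤ C * r ^ p := by positivity
      have h6 : 0 ≤ C * (r ^ 2 + s) ^ (p / 2) := by positivity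
      rw [abs_le]
      constructor <;> nlinarith
    · have h1 := rpow_sub_two_mul_le hr hs hp
      have h2 := sq_add_rpow_mul_le (e := p) hr hs
      have h3 : |p * (r ^ 2 + s) ^ (p / 2 - 1) - C * (p * r ^ (p - 2))| ≤
          p * (r ^ 2 + s) ^ (p / 2 - 1) + C * (p * r ^ (p - 2)) := by
        refine (abs_sub _ _).trans (le_of_eq ?_)
        rw [abs_of_nonneg (by positivity), abs_of_nonneg (by positivity)]
      have h4 := mul_le_mul_of_nonneg_right h3 hr
      have h5 := mul_le_mul_of_nonneg_left h1 (by positivity : 0 ≤ C * p)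
      have h6 := mul_le_mul_of_nonneg_left h2 (by positivity : 0 ≤ p)
      linarith

theorem isBellman_norm_of_le_two {p : ℝ} (hp : 1 < p) (hp2 : p ≤ 2) :
    IsBellman p (fun r s => (r ^ 2 + s) ^ (p / 2) - 28 * s ^ (p / 2))
      (fun r s => p * (r ^ 2 + s) ^ (p / 2 - 1)) where
  measurable_left := by unfold Function.uncurry; fun_prop
  measurable_right := by unfold Function.uncurry; fun_prop
  zero_le := by
    simp [Real.zero_rpow (by linarith : p / 2 ≠ 0)]
  step_of_pos {r r' δ τ s} h hδ hs := by
    have h1 := h.sq_add_rpow_le hp hp2 hδ hs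
    have h2 := le_rpow_tangent (by linarith : 0 ≤ p / 2) (by linarith)
      (by positivity : 0 < s + δ ^ 2) hs
    have h3 : (√(r ^ 2 + s) + δ) ^ (p - 2) ≤ (s + δ ^ 2) ^ (p / 2 - 1) := by
      rw [← sq_rpow_half (by positivity), show p / 2 - 1 = (p - 2) / 2 by ring]
      refine Real.rpow_le_rpow_of_nonpos (by positivity) ?_ (by linarith)
      nlinarith [Real.sq_sqrt (by positivity : 0 ≤ r ^ 2 + s), Real.sqrt_nonneg (r ^ 2 + s)]
    have h4 := mul_le_mul_of_nonneg_left h3 (sq_nonneg δ)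
    have h5 : 0 ≤ δ ^ 2 * (s + δ ^ 2) ^ (p / 2 - 1) := by positivity
    nlinarith
  growth := by
    refine ⟨p * 29, by positivity, fun r s hr hs => ⟨?_, ?_⟩⟩
    · have h1 : s ^ (p / 2) ≤ (r ^ 2 + s) ^ (p / 2) :=
        Real.rpow_le_rpow hs (by nlinarith) (by linarith)
      have h2 : 0 ≤ s ^ (p / 2) := by positivity
      rw [abs_le]
      constructor <;> nlinarith
    · have h2 := sq_add_rpow_mul_le (e := p) hr hs
      rw [abs_of_nonneg (by positivity)]
      have h3 : 0 ≤ (r ^ 2 + s) ^ ((p - 1) / 2) := by positivity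
      nlinarith

theorem isBellman_sq_of_two_le {p B : ℝ} (hp : 2 ≤ p) (hB : B = p / 2 * 2 ^ (p / 2)) :
    IsBellman p (fun r s => s ^ (p / 2) - B * (s ^ (p / 2 - 1) * r ^ 2) - 4 ^ p * B * r ^ p)
      (fun r s => -(2 * B * s ^ (p / 2 - 1) + 4 ^ p * B * (p * r ^ (p - 2)))) where
  measurable_left := by unfold Function.uncurry; fun_prop
  measurable_right := by unfold Function.uncurry; fun_prop
  zero_le := by
    simp [Real.zero_rpow (by linarith : p / 2 ≠ 0), Real.zero_rpow (by linarith : p ≠ 0)]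
  step_of_pos {r r' δ τ s} h hδ hs := by
    have hB0 : 0 ≤ B := by rw [hB]; positivity
    have hr := h.left_nonneg
    have h1 := rpow_tangent_le (by linarith : 1 ≤ p / 2) (by positivity : 0 ≤ s + δ ^ 2) hs
    have h2 := h.rpow_add_le_of_two_le hp
    have h3 := add_rpow_le_two_rpow_mul hs (sq_nonneg δ) (by linarith : 0 ≤ p / 2 - 1)
    have h4 : (δ ^ 2) ^ (p / 2 - 1) * δ ^ 2 = δ ^ p := by
      rw [← Real.rpow_add_one (by positivity), sub_add_cancel, sq_rpow_half hδ.le]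
    have h5 : (2 : ℝ) ^ (p / 2 - 1) ≤ 2 ^ (p / 2) :=
      Real.rpow_le_rpow_of_exponent_le (by norm_num) (by linarith)
    have h6 : p / 2 * (s + δ ^ 2) ^ (p / 2 - 1) * δ ^ 2 ≤ B * (s ^ (p / 2 - 1) * δ ^ 2 + δ ^ p) := by
      rw [← h4, ← add_mul, ← mul_assoc]
      refine mul_le_mul_of_nonneg_right ?_ (sq_nonneg δ)
      rw [hB, mul_assoc]
      refine mul_le_mul_of_nonneg_left (h3.trans ?_) (by linarith)
      exact mul_le_mul_of_nonneg_right h5 (by positivity)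
    have h7 : s ^ (p / 2 - 1) * r' ^ 2 ≤ (s + δ ^ 2) ^ (p / 2 - 1) * r' ^ 2 := by
      refine mul_le_mul_of_nonneg_right ?_ (sq_nonneg _)
      exact Real.rpow_le_rpow hs (by nlinarith) (by linarith)
    have h8 : 4 ^ p * B * ((1 / 4) ^ p * δ ^ p) = B * δ ^ p := by
      rw [Real.div_rpow (by norm_num) (by norm_num), Real.one_rpow]; field_simp
    have h9 := mul_le_mul_of_nonneg_left h2 (by positivity : 0 ≤ 4 ^ p * B)
    have h10 := mul_le_mul_of_nonneg_left h7 hB0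
    rw [h.sq_eq] at h10
    rw [h.sq_eq]
    linarith
  growth := by
    have hB0 : 0 ≤ B := by rw [hB]; positivity
    refine ⟨1 + 2 * B + 4 ^ p * B * p, by positivity, fun r s hr hs => ?_⟩
    have h0 : s ^ (p / 2 - 1) ≤ (r ^ 2 + s) ^ (p / 2 - 1) :=
      Real.rpow_le_rpow hs (by nlinarith) (by linarith)
    constructor
    · have h1 : s ^ (p / 2) ≤ (r ^ 2 + s) ^ (p / 2) :=
        Real.rpow_le_rpow hs (by nlinarith) (by linarith)
      have h2 := rpow_le_sq_add_rpow hr hs (by linarith : 0 ≤ p)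
      have h3 : s ^ (p / 2 - 1) * r ^ 2 ≤ (r ^ 2 + s) ^ (p / 2) := by
        calc _ ≤ (r ^ 2 + s) ^ (p / 2 - 1) * (r ^ 2 + s) := by gcongr; linarith
          _ = _ := by rw [← Real.rpow_add_one' (by positivity) (by linarith), sub_add_cancel]
      have h4 : 0 ≤ s ^ (p / 2) := by positivity
      have h5 : 0 ≤ B * (s ^ (p / 2 - 1) * r ^ 2) := by positivity
      have h6 : 0 ≤ 4 ^ p * B * r ^ p := by positivity
      have h7 := mul_le_mul_of_nonneg_left h3 hB0
      have h8 := mul_le_mul_of_nonneg_left h2 (by positivity : 0 ≤ 4 ^ p * B)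
      have h9 : 0 ≤ (r ^ 2 + s) ^ (p / 2) := by positivity
      have h10 : 4 ^ p * B * (r ^ 2 + s) ^ (p / 2) ≤ 4 ^ p * B * p * (r ^ 2 + s) ^ (p / 2) := by
        refine mul_le_mul_of_nonneg_right ?_ h9
        exact le_mul_of_one_le_right (by positivity) (by linarith)
      have h11 : 0 ≤ B * (r ^ 2 + s) ^ (p / 2) := by positivity
      rw [abs_le]
      constructor <;> nlinarith
    · have h1 := rpow_sub_two_mul_le hr hs (by linarith : 1 < p)
      have h2 := (mul_le_mul_of_nonneg_right h0 hr).trans (sq_add_rpow_mul_le (e := p) hr hs)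
      rw [abs_neg, abs_of_nonneg (by positivity)]
      have h5 := mul_le_mul_of_nonneg_left h1 (by positivity : 0 ≤ 4 ^ p * B * p)
      have h6 := mul_le_mul_of_nonneg_left h2 (by positivity : 0 ≤ 2 * B)
      have h7 : 0 ≤ (r ^ 2 + s) ^ ((p - 1) / 2) := by positivity
      linarith

theorem isBellman_norm_of_two_le {p A K : ℝ} (hp : 2 ≤ p) (hA : 0 ≤ A)
    (hK : K = A * p * 2 ^ (p + 1)) :
    IsBellman p (fun r s => A * r ^ p - (r ^ 2 + K * s) ^ (p / 2) - A * p ^ 2 * 2 ^ p * s ^ (p / 2))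
      (fun r s => A * (p * r ^ (p - 2)) - p * (r ^ 2 + K * s) ^ (p / 2 - 1)) where
  measurable_left := by unfold Function.uncurry; fun_prop
  measurable_right := by unfold Function.uncurry; fun_prop
  zero_le := by
    simp [Real.zero_rpow (by linarith : p / 2 ≠ 0), Real.zero_rpow (by linarith : p ≠ 0)]
  step_of_pos {r r' δ τ s} h hδ hs := by
    have hK0 : 0 ≤ K := by rw [hK]; positivity
    have hr := h.left_nonneg
    have hr' := h.right_nonneg
    have h1 := rpow_tangent_le (by linarith : 1 ≤ p / 2) (by positivity : 0 ≤ r ^ 2 + K * s)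
      (by positivity : 0 ≤ r' ^ 2 + K * (s + δ ^ 2))
    have h2 := mul_le_mul_of_nonneg_left (h.rpow_le_of_two_le hp) hA
    have h3 := Real.add_rpow_le_rpow_add hs (sq_nonneg δ) (by linarith : 1 ≤ p / 2)
    rw [sq_rpow_half hδ.le] at h3
    have h4 : δ ^ (p - 2) * δ ^ 2 = δ ^ p := by
      rw [← Real.rpow_two, ← Real.rpow_add hδ]; ring_nf
    have h5 := add_rpow_le_two_rpow_mul hr hδ.le (by linarith : 0 ≤ p - 2)
    have h6 : (2 : ℝ) ^ (p - 2) ≤ 2 ^ p :=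
      Real.rpow_le_rpow_of_exponent_le (by norm_num) (by linarith)
    have h7 : (r + δ) ^ (p - 2) * δ ^ 2 ≤ 2 ^ p * (r ^ (p - 2) * δ ^ 2 + δ ^ p) := by
      rw [← h4, ← add_mul, ← mul_assoc]
      refine mul_le_mul_of_nonneg_right (h5.trans ?_) (sq_nonneg δ)
      exact mul_le_mul_of_nonneg_right h6 (by positivity)
    have h8 := mul_le_mul_of_nonneg_left h7 (by positivity : 0 ≤ A * p ^ 2)
    have h9 := mul_le_mul_of_nonneg_left h3 (by positivity : 0 ≤ A * p ^ 2 * 2 ^ p)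
    have h10 : r ^ (p - 2) ≤ (r ^ 2 + K * s) ^ (p / 2 - 1) := by
      rw [← sq_rpow_half hr, show p / 2 - 1 = (p - 2) / 2 by ring]
      exact Real.rpow_le_rpow (by positivity) (by nlinarith) (by linarith)
    have h11 : p / 2 * (K + 1) * (r ^ (p - 2) * δ ^ 2) ≤
        p / 2 * (K + 1) * ((r ^ 2 + K * s) ^ (p / 2 - 1) * δ ^ 2) := by gcongr
    have h12 : A * p ^ 2 * 2 ^ p * (r ^ (p - 2) * δ ^ 2) ≤
        p / 2 * (K + 1) * (r ^ (p - 2) * δ ^ 2) := by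
      refine mul_le_mul_of_nonneg_right ?_ (by positivity)
      rw [hK, Real.rpow_add_one (by norm_num)]
      nlinarith
    have h13 : r' ^ 2 + K * (s + δ ^ 2) - (r ^ 2 + K * s) = 2 * τ + (K + 1) * δ ^ 2 := by
      rw [h.sq_eq]; ring
    rw [h13] at h1
    nlinarith
  growth := by
    have hK0 : 0 ≤ K := by rw [hK]; positivity
    have hgen : ∀ r s e : ℝ, 0 ≤ s → 0 ≤ e →
        (r ^ 2 + K * s) ^ e ≤ (1 + K) ^ e * (r ^ 2 + s) ^ e := by
      intro r s e hs he
      rw [← Real.mul_rpow (by positivity) (by positivity)]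
      exact Real.rpow_le_rpow (by positivity) (by nlinarith [sq_nonneg r]) he
    refine ⟨A * p + A * p ^ 2 * 2 ^ p + p * (1 + K) ^ (p / 2), by positivity,
      fun r s hr hs => ⟨?_, ?_⟩⟩
    · have h1 : s ^ (p / 2) ≤ (r ^ 2 + s) ^ (p / 2) :=
        Real.rpow_le_rpow hs (by nlinarith) (by linarith)
      have h2 := rpow_le_sq_add_rpow hr hs (by linarith : 0 ≤ p)
      have h3 := hgen r s (p / 2) hs (by linarith)
      have h4 : 0 ≤ (r ^ 2 + s) ^ (p / 2) := by positivity
      have h5 : 0 ≤ A * r ^ p := by positivity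
      have h6 : 0 ≤ A * p ^ 2 * 2 ^ p * s ^ (p / 2) := by positivity
      have h7 : 0 ≤ (r ^ 2 + K * s) ^ (p / 2) := by positivity
      have h8 := mul_le_mul_of_nonneg_left h2 hA
      have h9 := mul_le_mul_of_nonneg_left h1 (by positivity : 0 ≤ A * p ^ 2 * 2 ^ p)
      have h10 : A * (r ^ 2 + s) ^ (p / 2) ≤ A * p * (r ^ 2 + s) ^ (p / 2) := by
        refine mul_le_mul_of_nonneg_right ?_ h4
        exact le_mul_of_one_le_right (by positivity) (by linarith)
      have h11 : (1 + K) ^ (p / 2) * (r ^ 2 + s) ^ (p / 2) ≤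
          p * (1 + K) ^ (p / 2) * (r ^ 2 + s) ^ (p / 2) := by
        refine mul_le_mul_of_nonneg_right ?_ h4
        exact le_mul_of_one_le_left (by positivity) (by linarith)
      have h12 : 0 ≤ A * p ^ 2 * 2 ^ p * (r ^ 2 + s) ^ (p / 2) := by positivity
      rw [abs_le]
      constructor <;> linarith
    · have h1 := rpow_sub_two_mul_le hr hs (by linarith : 1 < p)
      have h2 := (mul_le_mul_of_nonneg_right (hgen r s (p / 2 - 1) hs (by linarith)) hr)
      have h3 := mul_le_mul_of_nonneg_left (sq_add_rpow_mul_le (e := p) hr hs)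
        (by positivity : 0 ≤ (1 + K) ^ (p / 2 - 1))
      have h4 : (1 + K) ^ (p / 2 - 1) ≤ (1 + K) ^ (p / 2) :=
        Real.rpow_le_rpow_of_exponent_le (by linarith) (by linarith)
      have h7 : 0 ≤ (r ^ 2 + s) ^ ((p - 1) / 2) := by positivity
      have h5 := mul_le_mul_of_nonneg_right h4 h7
      have h6 : (r ^ 2 + K * s) ^ (p / 2 - 1) * r ≤
        (1 + K) ^ (p / 2) * (r ^ 2 + s) ^ ((p - 1) / 2) := by linarith
      have h8 := mul_le_mul_of_nonneg_left h6 (by linarith : 0 ≤ p)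
      have h9 := mul_le_mul_of_nonneg_left h1 (by positivity : 0 ≤ A * p)
      have h10 : |A * (p * r ^ (p - 2)) - p * (r ^ 2 + K * s) ^ (p / 2 - 1)| ≤
          A * (p * r ^ (p - 2)) + p * (r ^ 2 + K * s) ^ (p / 2 - 1) := by
        refine (abs_sub _ _).trans (le_of_eq ?_)
        rw [abs_of_nonneg (by positivity), abs_of_nonneg (by positivity)]
      have h11 := mul_le_mul_of_nonneg_right h10 hr
      have h12 : 0 ≤ A * p ^ 2 * 2 ^ p * (r ^ 2 + s) ^ ((p - 1) / 2) := by positivity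
      linarith

theorem exists_isBellman_sq {p : ℝ} (hp : 1 < p) :
    ∃ U a C, IsBellman p U a ∧ 0 ≤ C ∧
      ∀ r s : ℝ, 0 ≤ r → 0 ≤ s → s ^ (p / 2) ≤ 2 * U r s + C * r ^ p := by
  rcases le_total p 2 with hp2 | hp2
  · have hp1 : 0 < p - 1 := by linarith
    refine ⟨_, _, 2 * (56 / (p - 1) + 2), isBellman_sq_of_le_two hp hp2, by positivity,
      fun r s hr hs => ?_⟩
    have h1 : s ^ (p / 2) ≤ (r ^ 2 + s) ^ (p / 2) :=
      Real.rpow_le_rpow hs (by nlinarith) (by linarith)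
    have h2 : 0 ≤ s ^ (p / 2) := by positivity
    linarith
  · obtain ⟨B, hB⟩ : ∃ B, B = p / 2 * 2 ^ (p / 2) := ⟨_, rfl⟩
    have hB0 : 0 ≤ B := by rw [hB]; positivity
    refine ⟨_, _, 2 * (4 ^ p * B + B * (2 * B) ^ (p / 2 - 1)), isBellman_sq_of_two_le hp2 hB,
      by positivity, fun r s hr hs => ?_⟩
    have hs1 : s ^ (p / 2) = s ^ (p / 2 - 1) * s := by
      rw [← Real.rpow_add_one' hs (by linarith), sub_add_cancel]
    have key : B * (s ^ (p / 2 - 1) * r ^ 2) ≤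
        s ^ (p / 2) / 2 + B * (2 * B) ^ (p / 2 - 1) * r ^ p := by
      have h0 : 0 ≤ s ^ (p / 2 - 1) := by positivity
      rcases le_total (B * r ^ 2) (s / 2) with hle | hle
      · have h2 : 0 ≤ B * (2 * B) ^ (p / 2 - 1) * r ^ p := by positivity
        nlinarith
      · have h2 : s ^ (p / 2 - 1) ≤ (2 * B * r ^ 2) ^ (p / 2 - 1) :=
          Real.rpow_le_rpow hs (by linarith) (by linarith)
        rw [Real.mul_rpow (by positivity) (by positivity)] at h2
        have h3 : (r ^ 2) ^ (p / 2 - 1) * r ^ 2 = r ^ p := by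
          rw [← Real.rpow_add_one' (by positivity) (by linarith), sub_add_cancel,
            sq_rpow_half hr]
        have h4 := mul_le_mul_of_nonneg_right h2 (by positivity : 0 ≤ B * r ^ 2)
        have h5 : 0 ≤ s ^ (p / 2) := by positivity
        rw [← h3]
        linarith
    linarith

theorem exists_isBellman_norm {p : ℝ} (hp : 1 < p) :
    ∃ U a C, IsBellman p U a ∧ 0 ≤ C ∧
      ∀ r s : ℝ, 0 ≤ r → 0 ≤ s → r ^ p ≤ 2 * U r s + C * s ^ (p / 2) := by
  rcases le_total p 2 with hp2 | hp2
  · refine ⟨_, _, 56, isBellman_norm_of_le_two hp hp2, by positivity, fun r s hr hs => ?_⟩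
    have h1 := rpow_le_sq_add_rpow hr hs (by linarith : 0 ≤ p)
    have h2 : 0 ≤ r ^ p := by positivity
    linarith
  · obtain ⟨A, hA⟩ : ∃ A : ℝ, A = 2 ^ (p / 2) + 1 := ⟨_, rfl⟩
    have hA0 : 0 ≤ A := by rw [hA]; positivity
    obtain ⟨K, hK⟩ : ∃ K, K = A * p * 2 ^ (p + 1) := ⟨_, rfl⟩
    have hK0 : 0 ≤ K := by rw [hK]; positivity
    refine ⟨_, _, 2 * (2 ^ (p / 2) * K ^ (p / 2) + A * p ^ 2 * 2 ^ p),
      isBellman_norm_of_two_le hp2 hA0 hK, by positivity, fun r s hr hs => ?_⟩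
    have h1 := add_rpow_le_two_rpow_mul (sq_nonneg r) (by positivity : 0 ≤ K * s)
      (by linarith : 0 ≤ p / 2)
    rw [Real.mul_rpow hK0 hs, sq_rpow_half hr] at h1
    have h2 : 0 ≤ r ^ p := by positivity
    simp only [hA] at *
    linarith

section BellmanStep

variable {Ω H : Type*} {m m0 : MeasurableSpace Ω} {μ : Measure Ω} [NormedAddCommGroup H]

theorem sq_add_rpow_half_le {r s e : ℝ} (hr : 0 ≤ r) (hs : 0 ≤ s) (he : 0 ≤ e) :
    (r ^ 2 + s) ^ (e / 2) ≤ (r + √s) ^ e := by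
  rw [← sq_rpow_half (by positivity : 0 ≤ r + √s)]
  refine Real.rpow_le_rpow (by positivity) ?_ (by positivity)
  nlinarith [Real.sq_sqrt hs, mul_nonneg hr (Real.sqrt_nonneg s)]

theorem IsBellman.integrable {p : ℝ} (hp : 1 < p) {U a : ℝ → ℝ → ℝ} (hU : IsBellman p U a)
    {X : Ω → H} {s : Ω → ℝ} (hX : MemLp X (.ofReal p) μ) (hsm : AEStronglyMeasurable s μ)
    (hs0 : ∀ ω, 0 ≤ s ω) (hs : MemLp (fun ω => √(s ω)) (.ofReal p) μ) :
    Integrable (fun ω => U ‖X ω‖ (s ω)) μ := by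
  obtain ⟨K, hK, hg⟩ := hU.growth
  have hp0 : ENNReal.ofReal p ≠ 0 := by simp; linarith
  have h1 := ((hX.norm.add hs).integrable_norm_rpow hp0 ofReal_ne_top).const_mul K
  rw [ENNReal.toReal_ofReal (by linarith)] at h1
  refine h1.mono' ?_ (ae_of_all _ fun ω => ?_)
  · exact (hU.measurable_left.comp_aemeasurable
      (hX.1.norm.aemeasurable.prodMk hsm.aemeasurable)).aestronglyMeasurable
  · refine (hg _ _ (norm_nonneg _) (hs0 ω)).1.trans (mul_le_mul_of_nonneg_left ?_ hK)
    refine (sq_add_rpow_half_le (norm_nonneg _) (hs0 ω) (by linarith)).trans_eq ?_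
    rw [Real.norm_of_nonneg]
    · rfl
    · exact add_nonneg (norm_nonneg _) (Real.sqrt_nonneg _)

theorem memLp_sqrt_add_sq {P : ℝ≥0∞} {D : Ω → H} {s : Ω → ℝ} (hD : MemLp D P μ)
    (hsm : AEStronglyMeasurable s μ) (hs0 : ∀ ω, 0 ≤ s ω) (hs : MemLp (fun ω => √(s ω)) P μ) :
    MemLp (fun ω => √(s ω + ‖D ω‖ ^ 2)) P μ := by
  refine (hs.add hD.norm).mono ?_ (ae_of_all _ fun ω => ?_)
  · exact (hsm.add (hD.1.norm.pow 2)).aemeasurable.sqrt.aestronglyMeasurable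
  · rw [Real.norm_of_nonneg (Real.sqrt_nonneg _)]
    refine le_trans ?_ (le_abs_self _)
    refine Real.sqrt_le_iff.2 ⟨add_nonneg (Real.sqrt_nonneg _) (norm_nonneg _), ?_⟩
    have := mul_nonneg (Real.sqrt_nonneg (s ω)) (norm_nonneg (D ω))
    simp only [Pi.add_apply]
    nlinarith [Real.sq_sqrt (hs0 ω)]

variable [InnerProductSpace ℝ H]

theorem isIncrement_norm (x y : H) :
    IsIncrement ‖x‖ ‖y‖ ‖y - x‖ (inner ℝ x (y - x)) where
  left_nonneg := norm_nonneg x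
  right_nonneg := norm_nonneg y
  norm_nonneg := norm_nonneg _
  sq_eq := by simpa using norm_add_sq_real x (y - x)
  abs_inner_le := abs_real_inner_le_norm x (y - x)

theorem IsBellman.integral_step_le [CompleteSpace H] [IsFiniteMeasure μ] (hm : m ≤ m0)
    {p : ℝ} (hp : 1 < p)
    {U a : ℝ → ℝ → ℝ} (hU : IsBellman p U a) {X Y : Ω → H} {s : Ω → ℝ}
    (hXm : StronglyMeasurable[m] X) (hX : MemLp X (.ofReal p) μ) (hY : MemLp Y (.ofReal p) μ)
    (hsm : StronglyMeasurable[m] s)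
    (hs0 : ∀ ω, 0 ≤ s ω) (hs : MemLp (fun ω => √(s ω)) (.ofReal p) μ) (hXY : μ[Y|m] =ᵐ[μ] X) :
    ∫ ω, U ‖Y ω‖ (s ω + ‖Y ω - X ω‖ ^ 2) ∂μ ≤ ∫ ω, U ‖X ω‖ (s ω) ∂μ := by
  obtain ⟨K, hK, hg⟩ := hU.growth
  have hp0 : ENNReal.ofReal p ≠ 0 := by simp; linarith
  have hp1 : 1 ≤ ENNReal.ofReal p := by simpa using hp.le
  have hsm' := hsm.mono hm
  have hD : MemLp (fun ω => Y ω - X ω) (.ofReal p) μ := hY.sub hX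
  have hXi := hX.integrable hp1
  have hYi := hY.integrable hp1
  have ham : StronglyMeasurable[m] fun ω => a ‖X ω‖ (s ω) :=
    (hU.measurable_right.comp (hXm.norm.measurable.prodMk hsm.measurable)).stronglyMeasurable
  have hi : Integrable (fun ω => a ‖X ω‖ (s ω) * inner ℝ (X ω) (Y ω - X ω)) μ := by
    have h1 := (((hX.norm.add hs).add hD.norm).integrable_norm_rpow hp0 ofReal_ne_top).const_mul K
    rw [ENNReal.toReal_ofReal (by linarith)] at h1
    refine h1.mono' ((ham.mono hm).aestronglyMeasurable.mul (hX.1.inner hD.1))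
      (ae_of_all _ fun ω => ?_)
    have h2 := (hg _ _ (norm_nonneg (X ω)) (hs0 ω)).2
    have h3 := abs_real_inner_le_norm (X ω) (Y ω - X ω)
    have h4 := sq_add_rpow_half_le (norm_nonneg (X ω)) (hs0 ω) (by linarith : 0 ≤ p - 1)
    have hG : 0 ≤ ‖X ω‖ + √(s ω) := by positivity
    simp only [Pi.add_apply]
    rw [Real.norm_eq_abs, abs_mul, Real.norm_of_nonneg (by positivity)]
    calc |a ‖X ω‖ (s ω)| * |inner ℝ (X ω) (Y ω - X ω)|
        ≤ |a ‖X ω‖ (s ω)| * (‖X ω‖ * ‖Y ω - X ω‖) := by gcongr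
      _ = (|a ‖X ω‖ (s ω)| * ‖X ω‖) * ‖Y ω - X ω‖ := by ring
      _ ≤ (K * (‖X ω‖ + √(s ω)) ^ (p - 1)) * ‖Y ω - X ω‖ := by
          exact mul_le_mul_of_nonneg_right (h2.trans (mul_le_mul_of_nonneg_left h4 hK))
            (norm_nonneg _)
      _ = K * ((‖X ω‖ + √(s ω)) ^ (p - 1) * ‖Y ω - X ω‖) := by ring
      _ ≤ K * ((‖X ω‖ + √(s ω) + ‖Y ω - X ω‖) ^ (p - 1) * (‖X ω‖ + √(s ω) + ‖Y ω - X ω‖)) := by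
          refine mul_le_mul_of_nonneg_left (mul_le_mul ?_ ?_ (norm_nonneg _) (by positivity)) hK
          · exact Real.rpow_le_rpow hG (by linarith [norm_nonneg (Y ω - X ω)]) (by linarith)
          · linarith
      _ = K * (‖X ω‖ + √(s ω) + ‖Y ω - X ω‖) ^ p := by
          rw [← Real.rpow_add_one' (by positivity) (by linarith)]; simp
  have hzero : ∫ ω, a ‖X ω‖ (s ω) * inner ℝ (X ω) (Y ω - X ω) ∂μ = 0 := by
    have hi' : Integrable (fun ω => innerSL ℝ (a ‖X ω‖ (s ω) • X ω) (Y ω - X ω)) μ := by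
      simpa [inner_smul_left] using hi
    have h1 := condExp_bilin_of_stronglyMeasurable_left (innerSL ℝ) (ham.smul hXm) hi'
      (hYi.sub hXi)
    have h2 : μ[fun ω => Y ω - X ω|m] =ᵐ[μ] 0 := by
      refine (condExp_sub hYi hXi m).trans ?_
      rw [condExp_of_stronglyMeasurable hm hXm hXi]
      filter_upwards [hXY] with ω h
      simp [h]
    have h3 : ∫ ω, innerSL ℝ (a ‖X ω‖ (s ω) • X ω) (Y ω - X ω) ∂μ = 0 := by
      rw [← integral_condExp hm]
      refine integral_eq_zero_of_ae ?_
      filter_upwards [h1, h2] with ω h1 h2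
      refine h1.trans ?_
      simp [h2]
    simpa [inner_smul_left] using h3
  have hUi := hU.integrable hp hX hsm'.aestronglyMeasurable hs0 hs
  calc ∫ ω, U ‖Y ω‖ (s ω + ‖Y ω - X ω‖ ^ 2) ∂μ
      ≤ ∫ ω, (U ‖X ω‖ (s ω) + a ‖X ω‖ (s ω) * inner ℝ (X ω) (Y ω - X ω)) ∂μ := by
        refine integral_mono (hU.integrable hp hY ?_ (fun ω => by have := hs0 ω; positivity)
          (memLp_sqrt_add_sq hD hsm'.aestronglyMeasurable hs0 hs)) (hUi.add hi)
          fun ω => hU.step (isIncrement_norm _ _) (hs0 ω)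
        exact hsm'.aestronglyMeasurable.add (hD.1.norm.pow 2)
    _ = ∫ ω, U ‖X ω‖ (s ω) ∂μ := by rw [integral_add hUi hi, hzero, add_zero]

end BellmanStep

section SquareFunction

variable {Ω H : Type*} {m0 : MeasurableSpace Ω} {μ : Measure Ω} [NormedAddCommGroup H]

/-- The square of the martingale square function, stopped at time `n`. -/
def sqFun (M : ℕ → Ω → H) (n : ℕ) (ω : Ω) : ℝ :=
  ‖M 0 ω‖ ^ 2 + ∑ j ∈ Finset.range n, ‖M (j + 1) ω - M j ω‖ ^ 2

/-- The square of the full martingale square function. -/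
def esqFun (M : ℕ → Ω → H) (ω : Ω) : ℝ≥0∞ :=
  ‖M 0 ω‖ₑ ^ 2 + ∑' j, ‖M (j + 1) ω - M j ω‖ₑ ^ 2

theorem sqFun_nonneg (M : ℕ → Ω → H) (n : ℕ) (ω : Ω) : 0 ≤ sqFun M n ω := by
  unfold sqFun; positivity

theorem sqFun_succ (M : ℕ → Ω → H) (n : ℕ) (ω : Ω) :
    sqFun M (n + 1) ω = sqFun M n ω + ‖M (n + 1) ω - M n ω‖ ^ 2 := by
  simp [sqFun, Finset.sum_range_succ, add_assoc]

theorem monotone_sqFun (M : ℕ → Ω → H) (ω : Ω) : Monotone fun n => sqFun M n ω :=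
  monotone_nat_of_le_succ fun n => by rw [sqFun_succ]; linarith [sq_nonneg ‖M (n + 1) ω - M n ω‖]

theorem ofReal_sqFun (M : ℕ → Ω → H) (n : ℕ) (ω : Ω) :
    ENNReal.ofReal (sqFun M n ω) =
      ‖M 0 ω‖ₑ ^ 2 + ∑ j ∈ Finset.range n, ‖M (j + 1) ω - M j ω‖ₑ ^ 2 := by
  rw [sqFun, ENNReal.ofReal_add (by positivity) (by positivity),
    ENNReal.ofReal_sum_of_nonneg fun _ _ => by positivity]
  simp [ENNReal.ofReal_pow, ofReal_norm]

theorem tendsto_ofReal_sqFun (M : ℕ → Ω → H) (ω : Ω) :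
    Filter.Tendsto (fun n => ENNReal.ofReal (sqFun M n ω)) Filter.atTop (nhds (esqFun M ω)) := by
  simp only [ofReal_sqFun]
  exact (ENNReal.tendsto_nat_tsum _).const_add _

theorem ofReal_sqFun_le (M : ℕ → Ω → H) (n : ℕ) (ω : Ω) :
    ENNReal.ofReal (sqFun M n ω) ≤ esqFun M ω := by
  rw [ofReal_sqFun, esqFun]
  gcongr
  exact ENNReal.sum_le_tsum _

theorem stronglyMeasurable_sqFun {ℱ : Filtration ℕ m0} {M : ℕ → Ω → H}
    (hM : ∀ n, StronglyMeasurable[ℱ n] (M n)) (n : ℕ) : StronglyMeasurable[ℱ n] (sqFun M n) := by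
  refine .add (((hM 0).mono (ℱ.mono n.zero_le)).norm.pow 2) ?_
  refine Finset.stronglyMeasurable_fun_sum _ fun j hj => ?_
  have hj := Finset.mem_range.1 hj
  exact (((hM (j + 1)).mono (ℱ.mono hj)).sub ((hM j).mono (ℱ.mono hj.le))).norm.pow 2

theorem memLp_sqrt_sqFun {P : ℝ≥0∞} {M : ℕ → Ω → H} (hM : ∀ n, MemLp (M n) P μ) (n : ℕ) :
    MemLp (fun ω => √(sqFun M n ω)) P μ := by
  induction n with
  | zero => simpa [sqFun, Real.sqrt_sq_eq_abs] using (hM 0).norm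
  | succ n ih =>
    simp only [sqFun_succ]
    refine memLp_sqrt_add_sq ((hM (n + 1)).sub (hM n)) ?_ (sqFun_nonneg M n) ih
    refine .add ((hM 0).1.norm.pow 2) ?_
    exact Finset.aestronglyMeasurable_fun_sum _ fun j _ =>
      ((hM (j + 1)).1.sub (hM j).1).norm.pow 2

theorem lintegral_enorm_rpow_condExp_le [NormedSpace ℝ H] [CompleteSpace H]
    {m : MeasurableSpace Ω} {p : ℝ} (hp : 1 < p) (F : Ω → H) :
    ∫⁻ ω, ‖(μ[F|m]) ω‖ₑ ^ p ∂μ ≤ ∫⁻ ω, ‖F ω‖ₑ ^ p ∂μ := by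
  have h := eLpNorm_condExp_le_eLpNorm (μ := μ) (m := m) F
    (by simpa using hp.le : 1 ≤ ENNReal.ofReal p)
  have hp0 : ENNReal.ofReal p ≠ 0 := by simp; linarith
  rw [eLpNorm_eq_lintegral_rpow_enorm_toReal hp0 ofReal_ne_top,
    eLpNorm_eq_lintegral_rpow_enorm_toReal hp0 ofReal_ne_top,
    ENNReal.toReal_ofReal (by linarith)] at h
  exact (ENNReal.rpow_le_rpow_iff (by positivity)).1 h

theorem ofReal_norm_rpow {p : ℝ} (hp : 0 ≤ p) (x : H) :
    ENNReal.ofReal (‖x‖ ^ p) = ‖x‖ₑ ^ p := by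
  rw [← ENNReal.ofReal_rpow_of_nonneg (norm_nonneg _) hp, ofReal_norm]

theorem norm_sqrt_rpow {s : ℝ} (hs : 0 ≤ s) (p : ℝ) : ‖√s‖ ^ p = s ^ (p / 2) := by
  rw [Real.norm_of_nonneg (Real.sqrt_nonneg _), ← sq_rpow_half (Real.sqrt_nonneg _),
    Real.sq_sqrt hs]

theorem lintegral_ofReal_le_of_le_two_mul_add {A B u : Ω → ℝ} {C : ℝ} (hC : 0 ≤ C)
    (hA : Integrable A μ) (hB : Integrable B μ) (hu : Integrable u μ) (hA0 : 0 ≤ A) (hB0 : 0 ≤ B)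
    (hu0 : ∫ ω, u ω ∂μ ≤ 0) (h : ∀ ω, A ω ≤ 2 * u ω + C * B ω) :
    ∫⁻ ω, ENNReal.ofReal (A ω) ∂μ ≤ ENNReal.ofReal C * ∫⁻ ω, ENNReal.ofReal (B ω) ∂μ := by
  rw [← ofReal_integral_eq_lintegral_ofReal hA (ae_of_all _ hA0),
    ← ofReal_integral_eq_lintegral_ofReal hB (ae_of_all _ hB0), ← ENNReal.ofReal_mul hC]
  refine ENNReal.ofReal_le_ofReal ?_
  have h1 := integral_mono hA ((hu.const_mul 2).add (hB.const_mul C)) h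
  simp only [Pi.add_apply] at h1
  rw [integral_add (hu.const_mul 2) (hB.const_mul C), integral_const_mul, integral_const_mul] at h1
  linarith

variable [InnerProductSpace ℝ H] [CompleteSpace H] [IsFiniteMeasure μ]

theorem IsBellman.integral_sqFun_le_zero {p : ℝ} (hp : 1 < p) {U a : ℝ → ℝ → ℝ}
    (hU : IsBellman p U a) (ℱ : Filtration ℕ m0) {F : Ω → H} (hF : MemLp F (.ofReal p) μ)
    (n : ℕ) : ∫ ω, U ‖(μ[F|ℱ n]) ω‖ (sqFun (fun n => μ[F|ℱ n]) n ω) ∂μ ≤ 0 := by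
  have hp1 : 1 ≤ ENNReal.ofReal p := by simpa using hp.le
  have hM : ∀ n, MemLp (μ[F|ℱ n]) (.ofReal p) μ := fun n => hF.condExp hp1
  induction n with
  | zero =>
    refine integral_nonpos fun ω => ?_
    simpa [sqFun] using hU.apply_sq_le (norm_nonneg ((μ[F|ℱ 0]) ω))
  | succ n ih =>
    simp only [sqFun_succ]
    exact (hU.integral_step_le (ℱ.le n) hp stronglyMeasurable_condExp (hM n) (hM (n + 1))
      (stronglyMeasurable_sqFun (fun _ => stronglyMeasurable_condExp) n) (sqFun_nonneg _ n)
      (memLp_sqrt_sqFun hM n) (condExp_condExp_of_le (ℱ.mono n.le_succ) (ℱ.le _))).trans ih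

/-- The martingale square function is bounded by the terminal value in `L^p`. -/
theorem exists_lintegral_esqFun_le {p : ℝ} (hp : 1 < p) : ∃ C : ℝ≥0∞, C ≠ ∞ ∧
    ∀ {Ω H : Type} {m0 : MeasurableSpace Ω} {μ : Measure Ω} [NormedAddCommGroup H]
      [InnerProductSpace ℝ H] [CompleteSpace H] [IsFiniteMeasure μ] (ℱ : Filtration ℕ m0)
      {F : Ω → H}, MemLp F (.ofReal p) μ →
      ∫⁻ ω, esqFun (fun n => μ[F|ℱ n]) ω ^ (p / 2) ∂μ ≤ C * ∫⁻ ω, ‖F ω‖ₑ ^ p ∂μ := by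
  obtain ⟨U, a, C, hU, hC, h⟩ := exists_isBellman_sq hp
  refine ⟨ENNReal.ofReal C, ofReal_ne_top, fun {Ω H m0 μ} _ _ _ _ ℱ F hF => ?_⟩
  have hp0 : ENNReal.ofReal p ≠ 0 := by simp; linarith
  have hp1 : 1 ≤ ENNReal.ofReal p := by simpa using hp.le
  have hM : ∀ n, MemLp (μ[F|ℱ n]) (.ofReal p) μ := fun n => hF.condExp hp1
  have hS := fun n => ((stronglyMeasurable_sqFun (ℱ := ℱ) (M := fun n => μ[F|ℱ n])
    (fun _ => stronglyMeasurable_condExp) n).mono (ℱ.le n))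
  have key := lintegral_tendsto_of_tendsto_of_monotone (μ := μ)
    (f := fun n ω => ENNReal.ofReal (sqFun (fun n => μ[F|ℱ n]) n ω) ^ (p / 2))
    (F := fun ω => esqFun (fun n => μ[F|ℱ n]) ω ^ (p / 2))
    (fun n => ((hS n).measurable.ennreal_ofReal.pow_const _).aemeasurable)
    (ae_of_all _ fun ω i j hij => ENNReal.rpow_le_rpow
      (ENNReal.ofReal_le_ofReal (monotone_sqFun _ ω hij)) (by linarith))
    (ae_of_all _ fun ω => (ENNReal.continuous_rpow_const.tendsto _).comp (tendsto_ofReal_sqFun _ ω))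
  refine le_of_tendsto' key fun n => ?_
  refine le_trans ?_ (mul_le_mul_right (lintegral_enorm_rpow_condExp_le (m := ℱ n) hp F) _)
  have hA := (memLp_sqrt_sqFun hM n).integrable_norm_rpow hp0 ofReal_ne_top
  have hB := (hM n).integrable_norm_rpow hp0 ofReal_ne_top
  rw [ENNReal.toReal_ofReal (by linarith)] at hA hB
  have := lintegral_ofReal_le_of_le_two_mul_add hC hA hB
    (hU.integrable hp (hM n) (hS n).aestronglyMeasurable (sqFun_nonneg _ n) (memLp_sqrt_sqFun hM n))
    (fun ω => by positivity) (fun ω => by positivity) (hU.integral_sqFun_le_zero hp ℱ hF n)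
    (fun ω => ?_)
  · refine le_trans (lintegral_mono fun ω => ?_) (this.trans (mul_le_mul_right
      (lintegral_mono fun ω => (ofReal_norm_rpow (by linarith) _).le) _))
    rw [norm_sqrt_rpow (sqFun_nonneg _ _ _),
      ENNReal.ofReal_rpow_of_nonneg (sqFun_nonneg _ _ _) (by linarith)]
  · rw [norm_sqrt_rpow (sqFun_nonneg _ _ _)]
    exact h _ _ (norm_nonneg _) (sqFun_nonneg _ _ _)

theorem tendsto_ae_condExp_of_finiteDimensional [FiniteDimensional ℝ H] (ℱ : Filtration ℕ m0)
    {F : Ω → H} (hF : Integrable F μ) (hFm : StronglyMeasurable[⨆ n, ℱ n] F) :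
    ∀ᵐ ω ∂μ, Filter.Tendsto (fun n => (μ[F|ℱ n]) ω) Filter.atTop (nhds (F ω)) := by
  let b := stdOrthonormalBasis ℝ H
  have h1 : ∀ i, ∀ᵐ ω ∂μ, Filter.Tendsto (fun n => (μ[innerSL ℝ (b i) ∘ F|ℱ n]) ω) Filter.atTop
      (nhds (innerSL ℝ (b i) (F ω))) := fun i =>
    ((innerSL ℝ (b i)).integrable_comp hF).tendsto_ae_condExp
      ((innerSL ℝ (b i)).continuous.comp_stronglyMeasurable hFm)
  have h2 : ∀ i n, ∀ᵐ ω ∂μ, innerSL ℝ (b i) ((μ[F|ℱ n]) ω) = (μ[innerSL ℝ (b i) ∘ F|ℱ n]) ω :=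
    fun i n => (innerSL ℝ (b i)).comp_condExp_comm hF
  filter_upwards [ae_all_iff.2 h1, ae_all_iff.2 fun i => ae_all_iff.2 (h2 i)] with ω h1 h2
  have h3 := tendsto_finsetSum Finset.univ fun i _ => (h1 i).smul_const (b i)
  simp only [← h2, innerSL_apply_apply, b.sum_repr'] at h3
  exact h3

/-- The terminal value is bounded by the martingale square function in `L^p`. -/
theorem exists_lintegral_le_esqFun {p : ℝ} (hp : 1 < p) : ∃ C : ℝ≥0∞, C ≠ ∞ ∧
    ∀ {Ω H : Type} {m0 : MeasurableSpace Ω} {μ : Measure Ω} [NormedAddCommGroup H]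
      [InnerProductSpace ℝ H] [FiniteDimensional ℝ H] [IsFiniteMeasure μ] (ℱ : Filtration ℕ m0)
      {F : Ω → H}, MemLp F (.ofReal p) μ → StronglyMeasurable[⨆ n, ℱ n] F →
      ∫⁻ ω, ‖F ω‖ₑ ^ p ∂μ ≤ C * ∫⁻ ω, esqFun (fun n => μ[F|ℱ n]) ω ^ (p / 2) ∂μ := by
  obtain ⟨U, a, C, hU, hC, h⟩ := exists_isBellman_norm hp
  refine ⟨ENNReal.ofReal C, ofReal_ne_top, fun {Ω H m0 μ} _ _ _ _ ℱ F hF hFm => ?_⟩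
  have : CompleteSpace H := FiniteDimensional.complete ℝ H
  have hp0 : ENNReal.ofReal p ≠ 0 := by simp; linarith
  have hp1 : 1 ≤ ENNReal.ofReal p := by simpa using hp.le
  have hM : ∀ n, MemLp (μ[F|ℱ n]) (.ofReal p) μ := fun n => hF.condExp hp1
  have hS := fun n => ((stronglyMeasurable_sqFun (ℱ := ℱ) (M := fun n => μ[F|ℱ n])
    (fun _ => stronglyMeasurable_condExp) n).mono (ℱ.le n))
  have hlim := tendsto_ae_condExp_of_finiteDimensional ℱ (hF.integrable hp1) hFm
  have hbound : ∀ n, ∫⁻ ω, ‖(μ[F|ℱ n]) ω‖ₑ ^ p ∂μ ≤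
      ENNReal.ofReal C * ∫⁻ ω, esqFun (fun n => μ[F|ℱ n]) ω ^ (p / 2) ∂μ := by
    intro n
    have hA := (hM n).integrable_norm_rpow hp0 ofReal_ne_top
    have hB := (memLp_sqrt_sqFun hM n).integrable_norm_rpow hp0 ofReal_ne_top
    rw [ENNReal.toReal_ofReal (by linarith)] at hA hB
    have := lintegral_ofReal_le_of_le_two_mul_add hC hA hB
      (hU.integrable hp (hM n) (hS n).aestronglyMeasurable (sqFun_nonneg _ n)
        (memLp_sqrt_sqFun hM n))
      (fun ω => by positivity) (fun ω => by positivity) (hU.integral_sqFun_le_zero hp ℱ hF n)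
      (fun ω => ?_)
    · refine le_trans (lintegral_mono fun ω => (ofReal_norm_rpow (by linarith) _).ge)
        (this.trans (mul_le_mul_right (lintegral_mono fun ω => ?_) _))
      rw [norm_sqrt_rpow (sqFun_nonneg _ _ _),
        ← ENNReal.ofReal_rpow_of_nonneg (sqFun_nonneg _ _ _) (by linarith)]
      exact ENNReal.rpow_le_rpow (ofReal_sqFun_le _ _ _) (by linarith)
    · rw [norm_sqrt_rpow (sqFun_nonneg _ _ _)]
      exact h _ _ (norm_nonneg _) (sqFun_nonneg _ _ _)
  calc ∫⁻ ω, ‖F ω‖ₑ ^ p ∂μ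
      = ∫⁻ ω, Filter.liminf (fun n => ‖(μ[F|ℱ n]) ω‖ₑ ^ p) Filter.atTop ∂μ := by
        refine lintegral_congr_ae ?_
        filter_upwards [hlim] with ω hω
        exact (((ENNReal.continuous_rpow_const.tendsto _).comp
          ((continuous_enorm.tendsto _).comp hω)).liminf_eq).symm
    _ ≤ Filter.liminf (fun n => ∫⁻ ω, ‖(μ[F|ℱ n]) ω‖ₑ ^ p ∂μ) Filter.atTop :=
        lintegral_liminf_le' fun n => (hM n).1.enorm.pow_const _
    _ ≤ _ := Filter.liminf_le_of_frequently_le' (.of_forall hbound)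

end SquareFunction

namespace DyadicLattice

variable {N : ℕ} (D : DyadicLattice N) {j k : ℤ} {x y : EucN N} {Q : Set (EucN N)}

/-- The cube of generation `j` containing `x`. -/
def cubeAt (j : ℤ) (x : EucN N) : Set (EucN N) := (D.covers j x).choose

theorem cubeAt_mem (j : ℤ) (x : EucN N) : D.cubeAt j x ∈ D.gen j := (D.covers j x).choose_spec.1

theorem mem_cubeAt (j : ℤ) (x : EucN N) : x ∈ D.cubeAt j x := (D.covers j x).choose_spec.2

variable {D}

theorem cubeAt_eq (hQ : Q ∈ D.gen j) (hx : x ∈ Q) : D.cubeAt j x = Q :=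
  (D.pairwiseDisjoint j).elim_set (D.cubeAt_mem j x) hQ x (D.mem_cubeAt j x) hx

theorem cubeAt_eq_of_mem (h : y ∈ D.cubeAt j x) : D.cubeAt j y = D.cubeAt j x :=
  cubeAt_eq (D.cubeAt_mem j x) h

theorem antitone_cubeAt (x : EucN N) : Antitone fun j => D.cubeAt j x := by
  refine antitone_int_of_succ_le fun j => ?_
  obtain ⟨R, hR, hQR⟩ := D.nested j _ (D.cubeAt_mem (j + 1) x)
  rw [cubeAt_eq hR (hQR (D.mem_cubeAt _ x))]
  exact hQR

theorem _root_.dyCube_eq_pi (N : ℕ) (k : ℤ) (x : EucN N) :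
    dyCube N k x = Set.univ.pi fun i => Ico (x i) (x i + (2 : ℝ) ^ (-k)) := by
  ext y; simp [dyCube]

theorem measurableSet_of_mem (hQ : Q ∈ D.gen j) : MeasurableSet Q := by
  obtain ⟨x, rfl⟩ := D.cube_form j Q hQ
  rw [dyCube_eq_pi]
  exact .univ_pi fun _ => measurableSet_Ico

theorem countable_gen (D : DyadicLattice N) (j : ℤ) : (D.gen j).Countable := by
  refine (D.pairwiseDisjoint j).countable_of_nonempty_interior fun Q hQ => ?_
  obtain ⟨x, rfl⟩ := D.cube_form j Q hQ
  rw [id, dyCube_eq_pi, interior_pi_set finite_univ, univ_pi_nonempty_iff]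
  intro i
  have : (0 : ℝ) < 2 ^ (-j) := by positivity
  simpa using this

theorem measure_lt_top (σ : Measure (EucN N)) [IsLocallyFiniteMeasure σ] (hQ : Q ∈ D.gen j) :
    σ Q < ∞ := by
  obtain ⟨x, rfl⟩ := D.cube_form j Q hQ
  refine (measure_mono ?_).trans_lt
    (isCompact_univ_pi fun i => isCompact_Icc (a := x i) (b := x i + (2 : ℝ) ^ (-j))).measure_lt_top
  rw [dyCube_eq_pi]
  exact Set.pi_mono fun _ _ => Ico_subset_Icc_self

theorem dist_le_of_mem (hQ : Q ∈ D.gen j) (hx : x ∈ Q) (hy : y ∈ Q) :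
    dist x y ≤ (2 : ℝ) ^ (-j) := by
  obtain ⟨z, rfl⟩ := D.cube_form j Q hQ
  refine (dist_pi_le_iff (by positivity)).2 fun i => ?_
  rw [Real.dist_eq, abs_le]
  have := hx i
  have := hy i
  constructor <;> linarith

theorem gen_unique (hN : 1 ≤ N) (hj : Q ∈ D.gen j) (hk : Q ∈ D.gen k) : j = k := by
  obtain ⟨x, rfl⟩ := D.cube_form j Q hj
  obtain ⟨y, hy⟩ := D.cube_form k _ hk
  have h := congrArg volume hy
  rw [dyCube_eq_pi, dyCube_eq_pi, Real.volume_pi_Ico, Real.volume_pi_Ico] at h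
  simp only [add_sub_cancel_left, Finset.prod_const, Finset.card_univ, Fintype.card_fin] at h
  have h1 := congrArg ENNReal.toReal h
  rw [toReal_pow, toReal_pow, toReal_ofReal (by positivity), toReal_ofReal (by positivity),
    pow_left_inj₀ (by positivity) (by positivity) (by lia)] at h1
  have h2 := zpow_right_injective₀ (by norm_num : (0 : ℝ) < 2) (by norm_num) h1
  lia

variable (D)

theorem comap_cubeAt_le (j : ℤ) : MeasurableSpace.comap (D.cubeAt j) ⊤ ≤ MeasurableSpace.pi := by
  rintro _ ⟨T, -, rfl⟩
  have : D.cubeAt j ⁻¹' T = ⋃ Q ∈ D.gen j ∩ T, Q := by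
    ext x
    simp only [mem_preimage, mem_iUnion, exists_prop]
    exact ⟨fun h => ⟨_, ⟨D.cubeAt_mem j x, h⟩, D.mem_cubeAt j x⟩,
      fun ⟨Q, ⟨hQ, hT⟩, hx⟩ => by rwa [cubeAt_eq hQ hx]⟩
  rw [this]
  exact .biUnion ((D.countable_gen j).mono inter_subset_left) fun Q hQ => measurableSet_of_mem hQ.1

theorem monotone_comap_cubeAt : Monotone fun j => MeasurableSpace.comap (D.cubeAt j) ⊤ := by
  intro j k hjk
  rintro _ ⟨T, -, rfl⟩
  refine ⟨D.cubeAt k '' (D.cubeAt j ⁻¹' T), trivial, Subset.antisymm ?_ (subset_preimage_image _ _)⟩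
  rintro y ⟨x, hx, hxy⟩
  have hy : y ∈ D.cubeAt j x := antitone_cubeAt x hjk (hxy.symm.subset (D.mem_cubeAt k y))
  rwa [mem_preimage, cubeAt_eq_of_mem hy]

/-- The filtration generated by the dyadic cubes of generations `l, l + 1, …`. -/
def filtration (l : ℤ) : Filtration ℕ (MeasurableSpace.pi : MeasurableSpace (EucN N)) where
  seq n := MeasurableSpace.comap (D.cubeAt (l + n)) ⊤
  mono' _ _ h := D.monotone_comap_cubeAt (by gcongr)
  le' n := D.comap_cubeAt_le (l + n)

theorem measurableSet_filtration {l : ℤ} {n : ℕ} (hQ : Q ∈ D.gen (l + n)) :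
    MeasurableSet[D.filtration l n] Q := by
  refine ⟨{Q}, trivial, ?_⟩
  ext x
  exact ⟨fun h => h ▸ D.mem_cubeAt (l + n) x, cubeAt_eq hQ⟩

theorem le_iSup_filtration (l : ℤ) :
    (MeasurableSpace.pi : MeasurableSpace (EucN N)) ≤ ⨆ n, D.filtration l n := by
  refine (BorelSpace.measurable_eq (α := EucN N)).le.trans ?_
  refine MeasurableSpace.generateFrom_le fun U hU => ?_
  have : U = ⋃ n : ℕ, ⋃ Q ∈ {Q ∈ D.gen (l + n) | Q ⊆ U}, Q := by
    ext x
    simp only [mem_iUnion, exists_prop]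
    refine ⟨fun hx => ?_, fun ⟨n, Q, hQ, hx⟩ => hQ.2 hx⟩
    obtain ⟨ε, hε, hU⟩ := Metric.isOpen_iff.1 (show IsOpen U from hU) x hx
    have h1 : Filter.Tendsto (fun n : ℕ => (2 : ℝ) ^ (-(l + n))) Filter.atTop (nhds 0) := by
      have := (tendsto_pow_atTop_nhds_zero_of_lt_one (by norm_num : (0 : ℝ) ≤ 2⁻¹)
        (by norm_num)).const_mul ((2 : ℝ) ^ (-l))
      rw [mul_zero] at this
      refine this.congr fun n => ?_
      rw [neg_add, zpow_add₀ (by norm_num), zpow_neg _ (n : ℤ), zpow_natCast, inv_pow]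
    obtain ⟨n, hn⟩ := (h1.eventually (gt_mem_nhds hε)).exists
    exact ⟨n, _, ⟨D.cubeAt_mem (l + n) x, fun y hy => hU ((dist_le_of_mem (D.cubeAt_mem _ x) hy
      (D.mem_cubeAt _ x)).trans_lt hn)⟩, D.mem_cubeAt _ x⟩
  rw [this]
  refine .iUnion fun n => .biUnion ((D.countable_gen _).mono fun _ h => h.1) fun Q hQ => ?_
  exact le_iSup (fun n => D.filtration l n) n _ (D.measurableSet_filtration hQ.1)

theorem condExp_filtration {H : Type*} [NormedAddCommGroup H] [NormedSpace ℝ H] [CompleteSpace H]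
    (σ : Measure (EucN N)) [IsFiniteMeasure σ] {F : EucN N → H} (hF : Integrable F σ)
    (l : ℤ) (n : ℕ) : ∀ᵐ x ∂σ, (σ[F|D.filtration l n]) x = ⨍ y in D.cubeAt (l + n) x, F y ∂σ := by
  have h0 : ∀ᵐ x ∂σ, ∀ Q ∈ D.gen (l + n), σ Q = 0 → x ∉ Q :=
    (ae_ball_iff (D.countable_gen _)).2 fun Q _ => by
      by_cases h : σ Q = 0
      · filter_upwards [measure_eq_zero_iff_ae_notMem.1 h] with x hx _ using hx
      · simp [h]
  filter_upwards [h0] with x hx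
  set Q := D.cubeAt (l + n) x
  have hQ : Q ∈ D.gen (l + n) := D.cubeAt_mem _ x
  have hσ : σ Q ≠ 0 := fun h => hx Q hQ h (D.mem_cubeAt _ x)
  have hconst : ∀ y ∈ Q, (σ[F|D.filtration l n]) y = (σ[F|D.filtration l n]) x := fun y hy =>
    StronglyMeasurable.factorsThrough (mY := ⊤) (f := D.cubeAt (l + n)) stronglyMeasurable_condExp
      (cubeAt_eq_of_mem hy)
  have h1 := setIntegral_condExp ((D.filtration l).le n) hF (D.measurableSet_filtration hQ)
  rw [setIntegral_congr_fun (measurableSet_of_mem hQ) hconst, setIntegral_const] at h1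
  rw [setAverage_eq, ← h1, smul_smul, inv_mul_cancel₀, one_smul]
  simpa [measureReal_def, ENNReal.toReal_eq_zero_iff] using hσ

end DyadicLattice

theorem enorm_sq_euclideanSpace {ι : Type*} [Fintype ι] (v : EuclideanSpace ℝ ι) :
    ‖v‖ₑ ^ 2 = ∑ i, ‖v i‖ₑ ^ 2 := by
  rw [← ofReal_norm, ← ENNReal.ofReal_pow (norm_nonneg _), EuclideanSpace.norm_sq_eq,
    ENNReal.ofReal_sum_of_nonneg fun _ _ => by positivity]
  simp only [ENNReal.ofReal_pow (norm_nonneg _), ofReal_norm]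

theorem avgM_eq_setAverage {N : ℕ} (σ : Measure (EucN N)) (Q : Set (EucN N)) (g : EucN N → ℝ) :
    avgM σ Q g = ⨍ y in Q, g y ∂σ := by
  rw [avgM, setAverage_eq, measureReal_def, smul_eq_mul, div_eq_inv_mul]

namespace DyadicLattice

variable {N : ℕ} (D : DyadicLattice N) (σ : Measure (EucN N)) (g : EucN N → ℝ) (l : ℤ)

/-- The square of the dyadic martingale square function of `g`, started from generation `l`. -/
def dyadicSq (x : EucN N) : ℝ≥0∞ :=
  ‖avgM σ (D.cubeAt l x) g‖ₑ ^ 2 +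
    ∑' n : ℕ, ‖avgM σ (D.cubeAt (l + (n + 1 : ℕ)) x) g - avgM σ (D.cubeAt (l + n) x) g‖ₑ ^ 2

theorem measurable_comp_cubeAt {β : Type*} [MeasurableSpace β] (h : Set (EucN N) → β) (j : ℤ) :
    Measurable fun x => h (D.cubeAt j x) := by
  rintro s -
  exact D.comap_cubeAt_le j _ ⟨h ⁻¹' s, trivial, rfl⟩

theorem measurable_dyadicSq : Measurable (D.dyadicSq σ g l) := by
  have h := fun j => D.measurable_comp_cubeAt (fun Q => avgM σ Q g) j
  unfold dyadicSq
  exact ((h l).enorm.pow_const 2).add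
    (.tsum fun n => ((h _).sub (h _)).enorm.pow_const 2)

theorem tsum_avgM_mul_indE (x : EucN N) :
    ∑' Q : D.gen l, (‖avgM σ (Q : Set (EucN N)) g‖₊ : ℝ≥0∞) ^ 2 * indE (Q : Set (EucN N)) x =
      ‖avgM σ (D.cubeAt l x) g‖ₑ ^ 2 := by
  rw [tsum_eq_single ⟨D.cubeAt l x, D.cubeAt_mem l x⟩]
  · simp [indE, D.mem_cubeAt l x, enorm_eq_nnnorm]
  · rintro ⟨Q, hQ⟩ hne
    have hx : x ∉ Q := fun hx => hne (Subtype.ext (cubeAt_eq hQ hx).symm)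
    simp [indE, hx]

theorem mdiffS_of_notMem {Q : Set (EucN N)} {x : EucN N} (hx : x ∉ Q) : mdiffS D σ g Q x = 0 := by
  have : ∀ Q' : {R // D.child Q R},
      (Q' : Set (EucN N)).indicator (fun _ => avgM σ (Q' : Set (EucN N)) g) x = 0 := by
    rintro ⟨Q', k, -, -, hQ'⟩
    exact indicator_of_notMem (fun h => hx (hQ' h)) _
  simp [mdiffS, this, hx]

theorem mdiffS_cubeAt (hN : 1 ≤ N) (j : ℤ) (x : EucN N) :
    mdiffS D σ g (D.cubeAt j x) x =
      avgM σ (D.cubeAt (j + 1) x) g - avgM σ (D.cubeAt j x) g := by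
  have hc : D.child (D.cubeAt j x) (D.cubeAt (j + 1) x) :=
    ⟨j, D.cubeAt_mem j x, D.cubeAt_mem (j + 1) x, antitone_cubeAt x (by lia)⟩
  rw [mdiffS, tsum_eq_single ⟨_, hc⟩, indicator_of_mem (D.mem_cubeAt _ x),
    indicator_of_mem (D.mem_cubeAt _ x)]
  rintro ⟨Q', k, hk, hQ', _⟩ hne
  obtain rfl := gen_unique hN hk (D.cubeAt_mem j x)
  exact indicator_of_notMem (fun h => hne (Subtype.ext (cubeAt_eq hQ' h).symm)) _

theorem tsum_mdiffS (hN : 1 ≤ N) (x : EucN N) :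
    ∑' Q : {R // ∃ j : ℤ, l ≤ j ∧ R ∈ D.gen j},
      (‖mdiffS D σ g (Q : Set (EucN N)) x‖₊ : ℝ≥0∞) ^ 2 =
    ∑' n : ℕ, ‖avgM σ (D.cubeAt (l + (n + 1 : ℕ)) x) g - avgM σ (D.cubeAt (l + n) x) g‖ₑ ^ 2 := by
  let c : ℕ → {R // ∃ j : ℤ, l ≤ j ∧ R ∈ D.gen j} := fun n =>
    ⟨D.cubeAt (l + n) x, l + n, by lia, D.cubeAt_mem _ x⟩
  have hc : Function.Injective c := fun m n h => by
    have h1 : D.cubeAt (l + m) x = D.cubeAt (l + n) x := congrArg Subtype.val h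
    have := gen_unique hN (D.cubeAt_mem (l + m) x) (h1 ▸ D.cubeAt_mem (l + n) x)
    lia
  rw [← hc.tsum_eq]
  · refine tsum_congr fun n => ?_
    rw [mdiffS_cubeAt D σ g hN, enorm_eq_nnnorm]
    push_cast
    rw [add_assoc]
  · rintro ⟨Q, j, hj, hQ⟩ hsupp
    by_cases hx : x ∈ Q
    · refine ⟨(j - l).toNat, Subtype.ext ?_⟩
      change D.cubeAt (l + (j - l).toNat) x = Q
      rw [Int.toNat_of_nonneg (by lia), add_sub_cancel, cubeAt_eq hQ hx]
    · simp [mdiffS_of_notMem D σ g hx] at hsupp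

theorem tsum_add_tsum_eq_tsum_dyadicSq (hN : 1 ≤ N) (f : ℤ → EucN N → ℝ) (x : EucN N) :
    (∑' (k : ℤ) (Q : D.gen l),
        (‖avgM σ (Q : Set (EucN N)) (f k)‖₊ : ℝ≥0∞) ^ 2 * indE (Q : Set (EucN N)) x)
      + ∑' (k : ℤ) (Q : {R // ∃ j : ℤ, l ≤ j ∧ R ∈ D.gen j}),
        (‖mdiffS D σ (f k) (Q : Set (EucN N)) x‖₊ : ℝ≥0∞) ^ 2 =
    ∑' k : ℤ, D.dyadicSq σ (f k) l x := by
  simp only [D.tsum_avgM_mul_indE, D.tsum_mdiffS σ _ l hN, dyadicSq, ENNReal.tsum_add]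

variable {D σ l}

theorem esqFun_condExp_eq [IsLocallyFiniteMeasure σ] {Q₀ : Set (EucN N)} (hQ₀ : Q₀ ∈ D.gen l)
    {ι : Type*} [Fintype ι] {F : EucN N → EuclideanSpace ℝ ι} (hF : IntegrableOn F Q₀ σ) :
    ∀ᵐ x ∂σ.restrict Q₀, esqFun (fun n => (σ.restrict Q₀)[F|D.filtration l n]) x =
      ∑ i, D.dyadicSq σ (fun x => F x i) l x := by
  have : IsFiniteMeasure (σ.restrict Q₀) := ⟨by simpa using measure_lt_top σ hQ₀⟩
  have h := fun n => D.condExp_filtration (σ.restrict Q₀) hF l n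
  filter_upwards [ae_all_iff.2 h, ae_restrict_mem (measurableSet_of_mem hQ₀)] with x h hx
  have h' : ∀ n i, ((σ.restrict Q₀)[F|D.filtration l n]) x i =
      avgM σ (D.cubeAt (l + n) x) fun x => F x i := by
    intro n i
    have hsub : D.cubeAt (l + n) x ⊆ Q₀ :=
      (antitone_cubeAt x (by lia : l ≤ l + n)).trans (cubeAt_eq hQ₀ hx).subset
    rw [h n, avgM_eq_setAverage, setAverage_eq, setAverage_eq,
      Measure.restrict_restrict_of_subset hsub, measureReal_restrict_apply'
      (measurableSet_of_mem hQ₀), inter_eq_left.2 hsub]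
    have : ∫ y in D.cubeAt (l + n) x, F y i ∂σ = (∫ y in D.cubeAt (l + n) x, F y ∂σ) i :=
      (EuclideanSpace.proj i : EuclideanSpace ℝ ι →L[ℝ] ℝ).integral_comp_comm (hF.mono_set hsub)
    rw [PiLp.smul_apply, this]
  simp only [esqFun, enorm_sq_euclideanSpace, dyadicSq, PiLp.sub_apply, h', Finset.sum_add_distrib]
  rw [Summable.tsum_finsetSum fun _ _ => ENNReal.summable]
  simp

end DyadicLattice

theorem lintegral_tsum_rpow_le {α ι : Type*} [Denumerable ι] {m : MeasurableSpace α}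
    {σ : Measure α} {u v : ι → α → ℝ≥0∞} (hu : ∀ i, Measurable (u i)) {q : ℝ} (hq : 0 ≤ q)
    {C : ℝ≥0∞}
    (h : ∀ K : Finset ι, ∫⁻ x, (∑ i ∈ K, u i x) ^ q ∂σ ≤ C * ∫⁻ x, (∑ i ∈ K, v i x) ^ q ∂σ) :
    ∫⁻ x, (∑' i, u i x) ^ q ∂σ ≤ C * ∫⁻ x, (∑' i, v i x) ^ q ∂σ := by
  let e := (Denumerable.eqv ι).symm
  have key := lintegral_tendsto_of_tendsto_of_monotone (μ := σ)
    (f := fun n x => (∑ j ∈ Finset.range n, u (e j) x) ^ q)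
    (F := fun x => (∑' i, u i x) ^ q)
    (fun n => ((Finset.measurable_fun_sum _ fun j _ => hu (e j)).pow_const q).aemeasurable)
    (ae_of_all _ fun x i j hij => ENNReal.rpow_le_rpow
      (Finset.sum_le_sum_of_subset (Finset.range_mono hij)) hq)
    (ae_of_all _ fun x => (ENNReal.continuous_rpow_const.tendsto _).comp (by
      rw [← e.tsum_eq]; exact ENNReal.tendsto_nat_tsum _))
  refine le_of_tendsto' key fun n => ?_
  have h1 := h ((Finset.range n).map e.toEmbedding)
  simp only [Finset.sum_map, Equiv.coe_toEmbedding] at h1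
  refine h1.trans (mul_le_mul_right (lintegral_mono fun x => ENNReal.rpow_le_rpow ?_ hq) _)
  rw [← e.tsum_eq]
  exact ENNReal.sum_le_tsum _

namespace DyadicLattice

variable {N : ℕ} {D : DyadicLattice N} {σ : Measure (EucN N)}

theorem lintegral_le_of_forall_gen (l : ℤ) {u v : EucN N → ℝ≥0∞} {C : ℝ≥0∞}
    (h : ∀ Q ∈ D.gen l, ∫⁻ x in Q, u x ∂σ ≤ C * ∫⁻ x in Q, v x ∂σ) :
    ∫⁻ x, u x ∂σ ≤ C * ∫⁻ x, v x ∂σ := by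
  have : Countable (D.gen l) := (D.countable_gen l).to_subtype
  have hU : ⋃ Q : D.gen l, (Q : Set (EucN N)) = univ :=
    eq_univ_of_forall fun x => mem_iUnion.2 ⟨⟨_, D.cubeAt_mem l x⟩, D.mem_cubeAt l x⟩
  have hsum : ∀ w : EucN N → ℝ≥0∞,
      ∫⁻ x, w x ∂σ = ∑' Q : D.gen l, ∫⁻ x in (Q : Set (EucN N)), w x ∂σ := fun w => by
    rw [← lintegral_iUnion (s := fun Q : D.gen l => (Q : Set (EucN N)))
      (fun Q => measurableSet_of_mem Q.2) (fun P Q hPQ =>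
        D.pairwiseDisjoint l P.2 Q.2 fun h => hPQ (Subtype.ext h)), hU,
      Measure.restrict_univ]
  rw [hsum u, hsum v, ← ENNReal.tsum_mul_left]
  exact ENNReal.tsum_le_tsum fun Q => h Q Q.2

theorem lintegral_dyadicSq_comparable [IsLocallyFiniteMeasure σ] {p : ℝ} (hp : 1 < p)
    {C₁ C₂ : ℝ≥0∞}
    (h₁ : ∀ {Ω H : Type} {m0 : MeasurableSpace Ω} {μ : Measure Ω} [NormedAddCommGroup H]
      [InnerProductSpace ℝ H] [CompleteSpace H] [IsFiniteMeasure μ] (ℱ : Filtration ℕ m0)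
      {F : Ω → H}, MemLp F (.ofReal p) μ →
      ∫⁻ ω, esqFun (fun n => μ[F|ℱ n]) ω ^ (p / 2) ∂μ ≤ C₁ * ∫⁻ ω, ‖F ω‖ₑ ^ p ∂μ)
    (h₂ : ∀ {Ω H : Type} {m0 : MeasurableSpace Ω} {μ : Measure Ω} [NormedAddCommGroup H]
      [InnerProductSpace ℝ H] [FiniteDimensional ℝ H] [IsFiniteMeasure μ] (ℱ : Filtration ℕ m0)
      {F : Ω → H}, MemLp F (.ofReal p) μ → StronglyMeasurable[⨆ n, ℱ n] F →
      ∫⁻ ω, ‖F ω‖ₑ ^ p ∂μ ≤ C₂ * ∫⁻ ω, esqFun (fun n => μ[F|ℱ n]) ω ^ (p / 2) ∂μ)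
    (l : ℤ) {f : ℤ → EucN N → ℝ} (hf : ∀ k, Measurable (f k))
    (hfin : ∫⁻ x, (∑' k, ‖f k x‖ₑ ^ 2) ^ (p / 2) ∂σ ≠ ∞) (K : Finset ℤ) :
    ∫⁻ x, (∑ k ∈ K, D.dyadicSq σ (f k) l x) ^ (p / 2) ∂σ ≤
        C₁ * ∫⁻ x, (∑ k ∈ K, ‖f k x‖ₑ ^ 2) ^ (p / 2) ∂σ ∧
      ∫⁻ x, (∑ k ∈ K, ‖f k x‖ₑ ^ 2) ^ (p / 2) ∂σ ≤
        C₂ * ∫⁻ x, (∑ k ∈ K, D.dyadicSq σ (f k) l x) ^ (p / 2) ∂σ := by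
  have hp0 : ENNReal.ofReal p ≠ 0 := by simp; linarith
  have hp1 : 1 ≤ ENNReal.ofReal p := by simpa using hp.le
  let F : EucN N → EuclideanSpace ℝ K := fun x => WithLp.toLp 2 fun k => f k x
  have hFm : StronglyMeasurable F := Measurable.stronglyMeasurable <|
    (PiLp.continuous_toLp 2 _).measurable.comp (measurable_pi_lambda _ fun k => hf k)
  have hFn : ∀ x, ‖F x‖ₑ ^ p = (∑ k ∈ K, ‖f k x‖ₑ ^ 2) ^ (p / 2) := fun x => by
    rw [← Finset.sum_coe_sort K fun k => ‖f k x‖ₑ ^ 2, ← enorm_sq_euclideanSpace (F x),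
      ← ENNReal.rpow_natCast, ← ENNReal.rpow_mul]
    congr 1; push_cast; ring
  have hFp : MemLp F (.ofReal p) σ := by
    refine ⟨hFm.aestronglyMeasurable, ?_⟩
    rw [eLpNorm_lt_top_iff_lintegral_rpow_enorm_lt_top hp0 ofReal_ne_top,
      ENNReal.toReal_ofReal (by linarith)]
    refine (lintegral_mono fun x => ?_).trans_lt hfin.lt_top
    rw [hFn]
    exact ENNReal.rpow_le_rpow (ENNReal.sum_le_tsum K) (by linarith)
  have hesq : ∀ Q ∈ D.gen l,
      ∫⁻ x in Q, esqFun (fun n => (σ.restrict Q)[F|D.filtration l n]) x ^ (p / 2) ∂σ =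
        ∫⁻ x in Q, (∑ k ∈ K, D.dyadicSq σ (f k) l x) ^ (p / 2) ∂σ := fun Q hQ => by
    have : IsFiniteMeasure (σ.restrict Q) := ⟨by simpa using measure_lt_top σ hQ⟩
    refine lintegral_congr_ae ?_
    filter_upwards [esqFun_condExp_eq hQ (hFp.restrict Q |>.integrable hp1)] with x hx
    rw [hx, ← Finset.sum_coe_sort K fun k => D.dyadicSq σ (f k) l x]
  constructor
  · refine lintegral_le_of_forall_gen (D := D) l fun Q hQ => ?_
    have : IsFiniteMeasure (σ.restrict Q) := ⟨by simpa using measure_lt_top σ hQ⟩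
    simpa only [hesq Q hQ, hFn] using h₁ (D.filtration l) (hFp.restrict Q)
  · refine lintegral_le_of_forall_gen (D := D) l fun Q hQ => ?_
    have : IsFiniteMeasure (σ.restrict Q) := ⟨by simpa using measure_lt_top σ hQ⟩
    simpa only [hesq Q hQ, hFn] using h₂ (D.filtration l) (hFp.restrict Q)
      (hFm.mono (D.le_iSup_filtration l))

end DyadicLattice

/-- **vector-valued Burkholder inequality.** For `(f_k)_{k∈ℤ} ∈ L^p(σ;ℓ²)`
and any `l ∈ ℤ`, the `L^p(σ;ℓ²)` norm of `(f_k)` is comparable, with constants depending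
only on `p`, to
`‖(∑_k ∑_{Q∈𝒟_l} (⟨f_k⟩^σ_Q)² 1_Q + ∑_k ∑_{Q∈𝒟, l(Q) ≤ 2^{-l}} (Δ^σ_Q f_k)²)^{1/2}‖_{L^p(σ)}`. -/
theorem vector_valued_burkholder (p : ℝ) (hp : 1 < p) :
    ∃ c C : ℝ≥0∞, 0 < c ∧ C ≠ ∞ ∧
      ∀ (N : ℕ), 1 ≤ N →
      ∀ (D : DyadicLattice N) (σ : Measure (EucN N)), IsLocallyFiniteMeasure σ →
      ∀ (f : ℤ → EucN N → ℝ) (l : ℤ),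
        (∀ k, Measurable (f k)) →
        (∫⁻ x, (∑' k : ℤ, (‖f k x‖₊ : ℝ≥0∞) ^ 2) ^ (p / 2) ∂σ) ^ (1 / p) ≠ ∞ →
        c * (∫⁻ x, ((∑' (k : ℤ) (Q : D.gen l),
                  (‖avgM σ (Q : Set (EucN N)) (f k)‖₊ : ℝ≥0∞) ^ 2 * indE (Q : Set (EucN N)) x)
                + ∑' (k : ℤ) (Q : {R // ∃ j : ℤ, l ≤ j ∧ R ∈ D.gen j}),
                  (‖mdiffS D σ (f k) (Q : Set (EucN N)) x‖₊ : ℝ≥0∞) ^ 2) ^ (p / 2) ∂σ) ^ (1 / p)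
          ≤ (∫⁻ x, (∑' k : ℤ, (‖f k x‖₊ : ℝ≥0∞) ^ 2) ^ (p / 2) ∂σ) ^ (1 / p) ∧
        (∫⁻ x, (∑' k : ℤ, (‖f k x‖₊ : ℝ≥0∞) ^ 2) ^ (p / 2) ∂σ) ^ (1 / p)
          ≤ C * (∫⁻ x, ((∑' (k : ℤ) (Q : D.gen l),
                  (‖avgM σ (Q : Set (EucN N)) (f k)‖₊ : ℝ≥0∞) ^ 2 * indE (Q : Set (EucN N)) x)
                + ∑' (k : ℤ) (Q : {R // ∃ j : ℤ, l ≤ j ∧ R ∈ D.gen j}),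
                  (‖mdiffS D σ (f k) (Q : Set (EucN N)) x‖₊ : ℝ≥0∞) ^ 2) ^ (p / 2) ∂σ) ^ (1 / p) := by
  obtain ⟨C₁, hC₁, h₁⟩ := exists_lintegral_esqFun_le hp
  obtain ⟨C₂, hC₂, h₂⟩ := exists_lintegral_le_esqFun hp
  have hp' : 0 ≤ 1 / p := by positivity
  refine ⟨(C₁ ^ (1 / p) + 1)⁻¹, C₂ ^ (1 / p), ?_, ENNReal.rpow_ne_top_of_nonneg hp' hC₂, ?_⟩
  · simpa [ENNReal.inv_pos] using ENNReal.rpow_ne_top_of_nonneg hp' hC₁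
  intro N hN D σ hσ f l hf hfin
  have hfin' : ∫⁻ x, (∑' k, ‖f k x‖ₑ ^ 2) ^ (p / 2) ∂σ ≠ ∞ := fun h =>
    hfin (by simp only [← enorm_eq_nnnorm, h]; exact ENNReal.top_rpow_of_pos (by positivity))
  have h := D.lintegral_dyadicSq_comparable (σ := σ) hp h₁ h₂ l hf hfin'
  have h3 := lintegral_tsum_rpow_le (fun k => D.measurable_dyadicSq σ (f k) l)
    (by linarith : 0 ≤ p / 2) fun K => (h K).1
  have h4 := lintegral_tsum_rpow_le (fun k => (hf k).enorm.pow_const 2)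
    (by linarith : 0 ≤ p / 2) fun K => (h K).2
  simp only [D.tsum_add_tsum_eq_tsum_dyadicSq σ l hN f]
  simp only [← enorm_eq_nnnorm]
  have h3' := ENNReal.rpow_le_rpow h3 hp'
  have h4' := ENNReal.rpow_le_rpow h4 hp'
  rw [ENNReal.mul_rpow_of_nonneg _ _ hp'] at h3' h4'
  refine ⟨?_, h4'⟩
  rw [ENNReal.inv_mul_le_iff (by simp) (by simpa using ENNReal.rpow_ne_top_of_nonneg hp' hC₁)]
  exact h3'.trans (mul_le_mul_left le_self_add _)

end
end

section
/- (Vector-valued Carleson embedding theorem) Let 1<p<∞, γ∈(0,1), let σ be a Radon measure on ℝ^N, and let (f_k)_{k=1}^∞ ⊂ L^p(σ;ℓ²). For each k let 𝒮_k ⊂ 𝒟 be a γ-sparse collection with respect to σ. Then ‖(Σ_{k=1}^∞ Σ_{S∈𝒮_k} (⟨f_k⟩^σ_S)² 1_S)^{1/2}‖_{L^p(σ)} ≤ C(γ,p)·‖(Σ_{k=1}^∞ f_k²)^{1/2}‖_{L^p(σ)}. -/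
open MeasureTheory ENNReal Set

noncomputable section

/-- A collection `𝒮 ⊆ 𝒟` is `γ`-sparse with respect to `σ`: there are pairwise disjoint
measurable sets `E(Q) ⊆ Q` with `σ(E(Q)) ≥ γ·σ(Q)`. -/
def IsSparse {N : ℕ} (D : DyadicLattice N) (σ : Measure (EucN N)) (γ : ℝ)
    (𝒮 : Set (Set (EucN N))) : Prop :=
  𝒮 ⊆ D.cubes ∧ ∃ E : Set (EucN N) → Set (EucN N),
    (∀ Q ∈ 𝒮, MeasurableSet (E Q) ∧ E Q ⊆ Q ∧ ENNReal.ofReal γ * σ Q ≤ σ (E Q)) ∧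
    𝒮.PairwiseDisjoint E

/-- A countable family of measurable sets of finite measure, any two of which are nested or
disjoint. -/
structure IsNestedFamily {α : Type*} [MeasurableSpace α] (μ : Measure α) (𝒬 : Set (Set α)) :
    Prop where
  countable : 𝒬.Countable
  measurableSet : ∀ Q ∈ 𝒬, MeasurableSet Q
  measure_ne_top : ∀ Q ∈ 𝒬, μ Q ≠ ∞
  nested : ∀ Q ∈ 𝒬, ∀ R ∈ 𝒬, Q ⊆ R ∨ R ⊆ Q ∨ Disjoint Q R

/-- The maximal function `x ↦ sup_{x ∈ Q ∈ 𝒬} μ(Q)⁻¹ ∫_Q f dμ`. -/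
def famMax {α : Type*} [MeasurableSpace α] (μ : Measure α) (𝒬 : Set (Set α))
    (f : α → ℝ≥0∞) (x : α) : ℝ≥0∞ :=
  ⨆ Q ∈ 𝒬, Q.indicator (fun _ => ⨍⁻ y in Q, f y ∂μ) x

/-- The bound for the maximal operator on `L^s`, raised to the power `s`. -/
def maxConst (s : ℝ) : ℝ≥0∞ := ENNReal.ofReal (2 ^ s * s / (s - 1))

lemma maxConst_ne_zero {s : ℝ} (hs : 1 < s) : maxConst s ≠ 0 := by
  have : 0 < s - 1 := by linarith
  have : 0 < s := by linarith
  simp only [maxConst, ne_eq, ENNReal.ofReal_eq_zero, not_le]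
  positivity

lemma maxConst_ne_top (s : ℝ) : maxConst s ≠ ∞ := ENNReal.ofReal_ne_top

section MaximalFunction

variable {α : Type*} [MeasurableSpace α] {μ : Measure α} {𝒬 : Set (Set α)}

lemma laverage_le_famMax {f : α → ℝ≥0∞} {Q : Set α} (hQ : Q ∈ 𝒬) {x : α} (hx : x ∈ Q) :
    ⨍⁻ y in Q, f y ∂μ ≤ famMax μ 𝒬 f x := by
  refine le_trans ?_ (le_iSup₂ (f := fun (Q : Set α) (_ : Q ∈ 𝒬) =>
    Q.indicator (fun _ => ⨍⁻ y in Q, f y ∂μ) x) Q hQ)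
  simp [hx]

lemma lt_famMax_iff {f : α → ℝ≥0∞} {x : α} {t : ℝ≥0∞} :
    t < famMax μ 𝒬 f x ↔ ∃ Q ∈ 𝒬, x ∈ Q ∧ t < ⨍⁻ y in Q, f y ∂μ := by
  simp only [famMax, lt_iSup_iff, exists_prop]
  refine exists_congr fun Q => and_congr_right fun _ => ?_
  by_cases hx : x ∈ Q <;> simp [hx]

lemma IsNestedFamily.measurable_famMax (h : IsNestedFamily μ 𝒬) (f : α → ℝ≥0∞) :
    Measurable (famMax μ 𝒬 f) := by
  refine Measurable.biSup 𝒬 h.countable fun Q hQ => ?_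
  exact measurable_const.indicator (h.measurableSet Q hQ)

lemma IsNestedFamily.mono (h : IsNestedFamily μ 𝒬) {𝒮 : Set (Set α)} (h𝒮 : 𝒮 ⊆ 𝒬) :
    IsNestedFamily μ 𝒮 where
  countable := h.countable.mono h𝒮
  measurableSet Q hQ := h.measurableSet Q (h𝒮 hQ)
  measure_ne_top Q hQ := h.measure_ne_top Q (h𝒮 hQ)
  nested Q hQ R hR := h.nested Q (h𝒮 hQ) R (h𝒮 hR)

lemma IsNestedFamily.mul_measure_biUnion_finset_le (h : IsNestedFamily μ 𝒬) {f : α → ℝ≥0∞}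
    {t : ℝ≥0∞} (ht : ∀ Q ∈ 𝒬, t * μ Q ≤ ∫⁻ x in Q, f x ∂μ) (F : Finset (Set α))
    (hF : (F : Set (Set α)) ⊆ 𝒬) : t * μ (⋃ Q ∈ F, Q) ≤ ∫⁻ x, f x ∂μ := by
  classical
  set G := F.filter (fun Q => Maximal (· ∈ F) Q) with hG
  have hsub : (⋃ Q ∈ F, Q) ⊆ ⋃ Q ∈ G, Q := by
    refine iUnion₂_subset fun Q hQ => ?_
    obtain ⟨R, hQR, hR⟩ := F.exists_le_maximal hQ
    exact subset_trans hQR (subset_biUnion_of_mem (u := fun Q : Set α => Q)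
      (show R ∈ (G : Set (Set α)) by simpa [hG] using ⟨hR.prop, hR⟩))
  have hGF : ∀ Q ∈ G, Q ∈ 𝒬 := fun Q hQ => hF (Finset.mem_filter.1 hQ).1
  have hdisj : (G : Set (Set α)).PairwiseDisjoint id := by
    intro Q hQ R hR hne
    have hQ' := (Finset.mem_filter.1 hQ).2
    have hR' := (Finset.mem_filter.1 hR).2
    rcases h.nested Q (hGF Q hQ) R (hGF R hR) with hQR | hQR | hQR
    · exact (hne (hQ'.eq_of_le hR'.prop hQR)).elim
    · exact (hne (hR'.eq_of_le hQ'.prop hQR).symm).elim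
    · exact hQR
  calc t * μ (⋃ Q ∈ F, Q) ≤ t * ∑ Q ∈ G, μ Q := by
        gcongr
        exact (measure_mono hsub).trans (measure_biUnion_finset_le _ _)
    _ = ∑ Q ∈ G, t * μ Q := Finset.mul_sum ..
    _ ≤ ∑ Q ∈ G, ∫⁻ x in Q, f x ∂μ := Finset.sum_le_sum fun Q hQ => ht Q (hGF Q hQ)
    _ = ∫⁻ x in ⋃ Q ∈ G, Q, f x ∂μ :=
        (lintegral_biUnion_finset hdisj (fun Q hQ => h.measurableSet Q (hGF Q hQ)) f).symm
    _ ≤ ∫⁻ x, f x ∂μ := setLIntegral_le_lintegral _ _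

/-- The weak type `(1,1)` inequality with constant `1`. -/
lemma IsNestedFamily.mul_measure_lt_famMax_le (h : IsNestedFamily μ 𝒬) (f : α → ℝ≥0∞)
    (t : ℝ≥0∞) : t * μ {x | t < famMax μ 𝒬 f x} ≤ ∫⁻ x, f x ∂μ := by
  set 𝒞 : Set (Set α) := {Q ∈ 𝒬 | t < ⨍⁻ y in Q, f y ∂μ} with h𝒞
  have hC : IsNestedFamily μ 𝒞 := h.mono (sep_subset _ _)
  have ht : ∀ Q ∈ 𝒞, t * μ Q ≤ ∫⁻ x in Q, f x ∂μ := fun Q hQ => by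
    rw [← measure_mul_setLAverage f (hC.measure_ne_top Q hQ), mul_comm]
    gcongr
    exact hQ.2.le
  have hset : {x | t < famMax μ 𝒬 f x} = ⋃ Q ∈ 𝒞, Q := by
    ext x
    simp only [mem_ofPred_eq, lt_famMax_iff, mem_iUnion, exists_prop, h𝒞]
    exact exists_congr fun Q => by tauto
  have : Countable 𝒞 := hC.countable.to_subtype
  rw [hset, biUnion_eq_iUnion, iUnion_eq_iUnion_finset, Directed.measure_iUnion, ENNReal.mul_iSup]
  · refine iSup_le fun F => ?_
    classical
    have := hC.mul_measure_biUnion_finset_le ht (F.image Subtype.val) (by simp)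
    simpa using this
  · refine directed_of_isDirected_le fun F F' hFF' => ?_
    exact biUnion_subset_biUnion_left hFF'

lemma IsNestedFamily.mul_measure_two_mul_lt_famMax_le (h : IsNestedFamily μ 𝒬) {f : α → ℝ≥0∞}
    (hf : Measurable f) (t : ℝ≥0∞) :
    t * μ {x | 2 * t < famMax μ 𝒬 f x} ≤ ∫⁻ x in {x | t < f x}, f x ∂μ := by
  have hm : MeasurableSet {x | t < f x} := measurableSet_lt measurable_const hf
  rw [← lintegral_indicator hm]
  refine le_trans ?_ (h.mul_measure_lt_famMax_le _ t)
  gcongr t * μ ?_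
  intro x
  simp only [mem_ofPred_eq, lt_famMax_iff]
  rintro ⟨Q, hQ, hx, hlt⟩
  refine ⟨Q, hQ, hx, ?_⟩
  by_contra! hle
  refine hlt.not_ge ?_
  calc ⨍⁻ y in Q, f y ∂μ ≤ ⨍⁻ y in Q, ({x | t < f x}.indicator f y + t) ∂μ := by
        refine lintegral_mono fun y => ?_
        by_cases hy : t < f y
        · simp [hy]
        · simp [hy, not_lt.1 hy]
    _ = (⨍⁻ y in Q, {x | t < f x}.indicator f y ∂μ) + ⨍⁻ y in Q, t ∂μ :=
        lintegral_add_right _ measurable_const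
    _ ≤ t + t := by
        gcongr
        rw [setLAverage_eq, setLIntegral_const]
        exact ENNReal.div_le_of_le_mul le_rfl
    _ = 2 * t := (two_mul t).symm

lemma lintegral_Ioi_rpow_indicator {s : ℝ} (hs : 0 < s) (y : ℝ≥0∞) :
    ∫⁻ t in Ioi (0 : ℝ), {t : ℝ | ENNReal.ofReal t < y}.indicator
      (fun t => ENNReal.ofReal (t ^ (s - 1))) t = ENNReal.ofReal (1 / s) * y ^ s := by
  have hfin : ∀ Y : ℝ, 0 ≤ Y → ∫⁻ t in Ioi (0 : ℝ),
      {t : ℝ | ENNReal.ofReal t < ENNReal.ofReal Y}.indicator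
      (fun t => ENNReal.ofReal (t ^ (s - 1))) t
        = ENNReal.ofReal (1 / s) * ENNReal.ofReal Y ^ s := by
    intro Y hY
    have hset : {t : ℝ | ENNReal.ofReal t < ENNReal.ofReal Y} ∩ Ioi 0 = Ioo 0 Y := by
      ext t
      simp only [mem_inter_iff, mem_ofPred_eq, mem_Ioi, mem_Ioo]
      constructor
      · rintro ⟨h1, h2⟩
        exact ⟨h2, (ENNReal.ofReal_lt_ofReal_iff'.1 h1).1⟩
      · rintro ⟨h1, h2⟩
        exact ⟨ENNReal.ofReal_lt_ofReal_iff'.2 ⟨h2, h1.trans h2⟩, h1⟩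
    rw [lintegral_indicator (measurableSet_lt ENNReal.measurable_ofReal measurable_const),
      Measure.restrict_restrict
        (measurableSet_lt ENNReal.measurable_ofReal measurable_const), hset,
      ← Measure.restrict_congr_set Ioo_ae_eq_Ioc.symm]
    have hint : IntervalIntegrable (fun t : ℝ => t ^ (s - 1)) volume 0 Y :=
      intervalIntegral.intervalIntegrable_rpow' (by linarith)
    rw [← ofReal_integral_eq_lintegral_ofReal
      ((intervalIntegrable_iff_integrableOn_Ioc_of_le hY).1 hint),
      ← intervalIntegral.integral_of_le hY, integral_rpow (Or.inl (by linarith)),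
      ENNReal.ofReal_rpow_of_nonneg hY hs.le, ← ENNReal.ofReal_mul (by positivity)]
    · congr 1
      rw [sub_add_cancel, Real.zero_rpow hs.ne']
      ring
    · exact (ae_restrict_iff' measurableSet_Ioc).2 (.of_forall fun t ht => by
        have := ht.1.le
        positivity)
  by_cases hy : y = ∞
  · subst hy
    have hs' : ENNReal.ofReal (1 / s) ≠ 0 := by simpa using hs
    rw [ENNReal.top_rpow_of_pos hs, ENNReal.mul_top hs', eq_top_iff]
    have hlim : Filter.Tendsto (fun n : ℕ => ENNReal.ofReal (1 / s) * ENNReal.ofReal (n : ℝ) ^ s)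
        Filter.atTop (nhds ∞) := by
      have h1 : Filter.Tendsto (fun n : ℕ => ENNReal.ofReal (1 / s * (n : ℝ) ^ s))
          Filter.atTop (nhds ∞) := by
        refine ENNReal.tendsto_ofReal_atTop.comp (Filter.Tendsto.const_mul_atTop (by positivity) ?_)
        exact (tendsto_rpow_atTop hs).comp tendsto_natCast_atTop_atTop
      refine h1.congr fun n => ?_
      rw [ENNReal.ofReal_mul (by positivity), ENNReal.ofReal_rpow_of_nonneg (by positivity) hs.le]
    refine le_of_tendsto' hlim fun n => ?_
    rw [← hfin n (by positivity)]
    refine lintegral_mono fun t => indicator_le_indicator_of_subset ?_ (fun _ => zero_le) t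
    intro t _
    simp
  · lift y to NNReal using hy
    have := hfin y y.2
    simpa only [ENNReal.ofReal_coe_nnreal] using this

lemma lintegral_Ioi_rpow_mul_measure [SFinite μ] {s : ℝ} (hs : 0 < s) {g : α → ℝ≥0∞}
    (hg : Measurable g) {w : α → ℝ≥0∞} (hw : Measurable w) :
    ∫⁻ t in Ioi (0 : ℝ), ENNReal.ofReal (t ^ (s - 1)) *
        ∫⁻ x in {x | ENNReal.ofReal t < g x}, w x ∂μ
      = ENNReal.ofReal (1 / s) * ∫⁻ x, w x * g x ^ s ∂μ := by
  have hset : MeasurableSet {z : ℝ × α | ENNReal.ofReal z.1 < g z.2} :=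
    measurableSet_lt (ENNReal.measurable_ofReal.comp measurable_fst) (hg.comp measurable_snd)
  have hmeas : Measurable fun z : ℝ × α => {z : ℝ × α | ENNReal.ofReal z.1 < g z.2}.indicator
      (fun z => ENNReal.ofReal (z.1 ^ (s - 1)) * w z.2) z := by
    refine Measurable.indicator ?_ hset
    exact (ENNReal.measurable_ofReal.comp (measurable_fst.pow_const _)).mul
      (hw.comp measurable_snd)
  calc _ = ∫⁻ t in Ioi (0 : ℝ), (∫⁻ x, {z : ℝ × α | ENNReal.ofReal z.1 < g z.2}.indicator
      (fun z => ENNReal.ofReal (z.1 ^ (s - 1)) * w z.2) (t, x) ∂μ) := by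
        refine lintegral_congr fun t => ?_
        rw [← lintegral_const_mul _ hw,
          ← lintegral_indicator (measurableSet_lt measurable_const hg)]
        rfl
    _ = ∫⁻ x, (∫⁻ t in Ioi (0 : ℝ), {z : ℝ × α | ENNReal.ofReal z.1 < g z.2}.indicator
      (fun z => ENNReal.ofReal (z.1 ^ (s - 1)) * w z.2) (t, x)) ∂μ :=
        lintegral_lintegral_swap hmeas.aemeasurable
    _ = ∫⁻ x, ENNReal.ofReal (1 / s) * (w x * g x ^ s) ∂μ := by
        refine lintegral_congr fun x => ?_
        rw [mul_left_comm, ← lintegral_Ioi_rpow_indicator hs, ← lintegral_const_mul]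
        · refine lintegral_congr fun t => ?_
          by_cases ht : ENNReal.ofReal t < g x
          · simp [ht, mul_comm]
          · simp [ht]
        · refine Measurable.indicator (by fun_prop)
            (measurableSet_lt ENNReal.measurable_ofReal measurable_const)
    _ = _ := lintegral_const_mul _ (hw.mul (hg.pow_const _))

/-- The maximal function is bounded on `L^s` for `s > 1`. -/
lemma IsNestedFamily.lintegral_famMax_rpow_le [SFinite μ] (h : IsNestedFamily μ 𝒬) {s : ℝ}
    (hs : 1 < s) {f : α → ℝ≥0∞} (hf : Measurable f) :
    ∫⁻ x, famMax μ 𝒬 f x ^ s ∂μ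
      ≤ maxConst s * ∫⁻ x, f x ^ s ∂μ := by
  have hs0 : 0 < s := by linarith
  have hs1 : 0 < s - 1 := by linarith
  have hM := h.measurable_famMax f
  have key := lintegral_Ioi_rpow_mul_measure (μ := μ) hs0 (hM.div_const 2)
    (measurable_const (a := (1 : ℝ≥0∞)))
  have key2 := lintegral_Ioi_rpow_mul_measure (μ := μ) hs1 hf hf
  have hle : ENNReal.ofReal (1 / s) * ∫⁻ x, (famMax μ 𝒬 f x / 2) ^ s ∂μ
      ≤ ENNReal.ofReal (1 / (s - 1)) * ∫⁻ x, f x ^ s ∂μ := by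
    calc _ = _ := by simpa only [one_mul] using key.symm
      _ ≤ ∫⁻ t in Ioi (0 : ℝ), ENNReal.ofReal (t ^ (s - 1 - 1)) *
          ∫⁻ x in {x | ENNReal.ofReal t < f x}, f x ∂μ := by
        refine setLIntegral_mono' measurableSet_Ioi fun t (ht : 0 < t) => ?_
        have hsplit : ENNReal.ofReal (t ^ (s - 1))
            = ENNReal.ofReal (t ^ (s - 1 - 1)) * ENNReal.ofReal t := by
          rw [← ENNReal.ofReal_mul (by positivity), Real.rpow_sub_one ht.ne' (s - 1),
            div_mul_cancel₀ _ ht.ne']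
        rw [hsplit, mul_assoc]
        gcongr
        refine le_trans (le_of_eq ?_)
          (h.mul_measure_two_mul_lt_famMax_le hf (ENNReal.ofReal t))
        rw [setLIntegral_one]
        congr 2
        ext x
        simp only [mem_ofPred_eq]
        rw [ENNReal.lt_div_iff_mul_lt (by simp) (by simp), mul_comm]
      _ = _ := key2
      _ ≤ _ := by
        gcongr with x
        by_cases h0 : f x = 0
        · simp [h0]
        by_cases ht : f x = ∞
        · simp [ht, hs0]
        conv_lhs => rw [← ENNReal.rpow_one (f x), ← ENNReal.rpow_mul, one_mul]
        rw [← ENNReal.rpow_add _ _ h0 ht]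
        simp
  have hconst : ∫⁻ x, famMax μ 𝒬 f x ^ s ∂μ = ENNReal.ofReal (2 ^ s * s) *
      (ENNReal.ofReal (1 / s) * ∫⁻ x, (famMax μ 𝒬 f x / 2) ^ s ∂μ) := by
    rw [← mul_assoc, ← ENNReal.ofReal_mul (by positivity), ← lintegral_const_mul _ (by fun_prop)]
    refine lintegral_congr fun x => ?_
    rw [ENNReal.div_rpow_of_nonneg _ _ hs0.le, mul_assoc, mul_one_div_cancel hs0.ne', mul_one,
      ← ENNReal.ofReal_rpow_of_pos (by norm_num), ENNReal.ofReal_ofNat, ENNReal.mul_div_cancel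
      (by simp) (by simp)]
  rw [hconst]
  refine (mul_le_mul_right hle _).trans (le_of_eq ?_)
  rw [← mul_assoc, ← ENNReal.ofReal_mul (by positivity), mul_one_div, maxConst]

end MaximalFunction

section SparseSquareFunction

variable {α : Type*} [MeasurableSpace α] {μ : Measure α} {𝒬 : Set (Set α)}

/-- Each `S ∈ 𝒮` has a measurable subset carrying a `γ`-fraction of its mass, and these subsets
are pairwise disjoint. -/
def HasDisjointPortions (μ : Measure α) (γ : ℝ) (𝒮 : Set (Set α)) : Prop :=
  ∃ E : Set α → Set α,
    (∀ Q ∈ 𝒮, MeasurableSet (E Q) ∧ E Q ⊆ Q ∧ ENNReal.ofReal γ * μ Q ≤ μ (E Q)) ∧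
    𝒮.PairwiseDisjoint E

/-- The scalar Carleson embedding theorem. -/
lemma HasDisjointPortions.tsum_laverage_rpow_mul_measure_le [SFinite μ]
    (h : IsNestedFamily μ 𝒬) {γ : ℝ} (hγ : 0 < γ) {𝒮 : Set (Set α)} (h𝒮 : 𝒮 ⊆ 𝒬)
    (hE : HasDisjointPortions μ γ 𝒮) {s : ℝ} (hs : 1 < s) {f : α → ℝ≥0∞} (hf : Measurable f) :
    ∑' S : 𝒮, (⨍⁻ y in (S : Set α), f y ∂μ) ^ s * μ S
      ≤ (ENNReal.ofReal γ)⁻¹ * maxConst s * ∫⁻ x, f x ^ s ∂μ := by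
  obtain ⟨E, hE, hdisj⟩ := hE
  have hγ0 : ENNReal.ofReal γ ≠ 0 := by simpa using hγ
  have : Countable 𝒮 := (h.countable.mono h𝒮).to_subtype
  have key : ENNReal.ofReal γ * ∑' S : 𝒮, (⨍⁻ y in (S : Set α), f y ∂μ) ^ s * μ S
      ≤ maxConst s * ∫⁻ x, f x ^ s ∂μ := by
    rw [← ENNReal.tsum_mul_left]
    calc _ ≤ ∑' S : 𝒮, ∫⁻ x in E S, famMax μ 𝒬 f x ^ s ∂μ := by
          refine ENNReal.tsum_le_tsum fun S => ?_
          obtain ⟨hm, hsub, hle⟩ := hE S S.2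
          rw [mul_left_comm]
          calc _ ≤ (⨍⁻ y in (S : Set α), f y ∂μ) ^ s * μ (E S) := by gcongr
            _ = ∫⁻ x in E S, (⨍⁻ y in (S : Set α), f y ∂μ) ^ s ∂μ := by simp
            _ ≤ _ := setLIntegral_mono' hm fun x hx => by
              gcongr
              exact laverage_le_famMax (h𝒮 S.2) (hsub hx)
      _ = ∫⁻ x in ⋃ S : 𝒮, E S, famMax μ 𝒬 f x ^ s ∂μ :=
          (lintegral_iUnion (fun S : 𝒮 => (hE S S.2).1) (hdisj.subtype _ _) _).symm
      _ ≤ ∫⁻ x, famMax μ 𝒬 f x ^ s ∂μ := setLIntegral_le_lintegral _ _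
      _ ≤ _ := h.lintegral_famMax_rpow_le hs hf
  rw [mul_assoc, mul_comm, ← div_eq_mul_inv, ENNReal.le_div_iff_mul_le (.inl hγ0) (.inl (by simp)),
    mul_comm]
  exact key

/-- The square of the sparse square function `(∑_k ∑_{S ∈ 𝒮_k} ⟨φ_k⟩_S² 1_S)^{1/2}`. -/
def sparseSq (μ : Measure α) (𝒮 : ℕ → Set (Set α)) (φ : ℕ → α → ℝ≥0∞) (x : α) : ℝ≥0∞ :=
  ∑' (k : ℕ) (S : 𝒮 k), (⨍⁻ y in (S : Set α), φ k y ∂μ) ^ 2 * (S : Set α).indicator 1 x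

variable {𝒮 : ℕ → Set (Set α)} {φ : ℕ → α → ℝ≥0∞}

lemma measurable_sparseSq (h : IsNestedFamily μ 𝒬) (h𝒮 : ∀ k, 𝒮 k ⊆ 𝒬) :
    Measurable (sparseSq μ 𝒮 φ) := by
  have : ∀ k, Countable (𝒮 k) := fun k => (h.countable.mono (h𝒮 k)).to_subtype
  refine Measurable.tsum fun k => Measurable.tsum fun S => ?_
  exact (measurable_one.indicator (h.measurableSet S (h𝒮 k S.2))).const_mul _

lemma lintegral_sparseSq_mul (h : IsNestedFamily μ 𝒬) (h𝒮 : ∀ k, 𝒮 k ⊆ 𝒬) {w : α → ℝ≥0∞}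
    (hw : Measurable w) :
    ∫⁻ x, sparseSq μ 𝒮 φ x * w x ∂μ
      = ∑' (k : ℕ) (S : 𝒮 k), (⨍⁻ y in (S : Set α), φ k y ∂μ) ^ 2 * ∫⁻ x in S, w x ∂μ := by
  have hc : ∀ k, Countable (𝒮 k) := fun k => (h.countable.mono (h𝒮 k)).to_subtype
  have hm : ∀ k (S : 𝒮 k), Measurable fun x =>
      (⨍⁻ y in (S : Set α), φ k y ∂μ) ^ 2 * (S : Set α).indicator 1 x * w x := fun k S =>
    ((measurable_one.indicator (h.measurableSet S (h𝒮 k S.2))).const_mul _).mul hw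
  simp only [sparseSq, ← ENNReal.tsum_mul_right]
  rw [lintegral_tsum fun k => (Measurable.tsum fun S => hm k S).aemeasurable]
  refine tsum_congr fun k => ?_
  rw [lintegral_tsum fun S => (hm k S).aemeasurable]
  refine tsum_congr fun S => ?_
  rw [← lintegral_indicator (h.measurableSet S (h𝒮 k S.2)), ← lintegral_const_mul _
    (hw.indicator (h.measurableSet S (h𝒮 k S.2)))]
  refine lintegral_congr fun x => ?_
  by_cases hx : x ∈ (S : Set α) <;> simp [hx]

lemma lintegral_sparseSq_mul_le [SFinite μ] (h : IsNestedFamily μ 𝒬) {γ : ℝ} (hγ : 0 < γ)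
    (h𝒮 : ∀ k, 𝒮 k ⊆ 𝒬) (hE : ∀ k, HasDisjointPortions μ γ (𝒮 k))
    (hφ : ∀ k, Measurable (φ k)) {w : α → ℝ≥0∞} (hw : Measurable w) :
    ∫⁻ x, sparseSq μ 𝒮 φ x * w x ∂μ
      ≤ (ENNReal.ofReal γ)⁻¹ * maxConst 2 * ∫⁻ x, (∑' k, φ k x ^ 2) * famMax μ 𝒬 w x ∂μ := by
  have hM := h.measurable_famMax w
  have hM2 : ∀ k, Measurable fun x => φ k x * famMax μ 𝒬 w x ^ (1 / 2 : ℝ) := fun k =>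
    (hφ k).mul (hM.pow_const _)
  have hsq : ∀ a : ℝ≥0∞, (a ^ (1 / 2 : ℝ)) ^ 2 = a := fun a => by
    rw [← ENNReal.rpow_natCast, ← ENNReal.rpow_mul]
    norm_num
  rw [lintegral_sparseSq_mul h h𝒮 hw]
  calc _ ≤ ∑' (k : ℕ), (ENNReal.ofReal γ)⁻¹ * maxConst 2 *
        ∫⁻ x, (φ k x * famMax μ 𝒬 w x ^ (1 / 2 : ℝ)) ^ (2 : ℝ) ∂μ := by
        refine ENNReal.tsum_le_tsum fun k => le_trans (ENNReal.tsum_le_tsum fun S => ?_)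
          ((hE k).tsum_laverage_rpow_mul_measure_le h hγ (h𝒮 k) one_lt_two (hM2 k))
        rw [← measure_mul_setLAverage w (h.measure_ne_top S (h𝒮 k S.2)), mul_comm (μ (S : Set α)),
          ← mul_assoc]
        gcongr
        rw [← hsq (⨍⁻ y in (S : Set α), w y ∂μ), ← mul_pow, ENNReal.rpow_two]
        gcongr
        calc _ = ⨍⁻ y in (S : Set α), φ k y * (⨍⁻ y in (S : Set α), w y ∂μ) ^ (1 / 2 : ℝ) ∂μ :=
              (lintegral_mul_const _ (hφ k)).symm
          _ ≤ _ := by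
              refine laverage_mono_ae (ae_restrict_of_forall_mem
                (h.measurableSet S (h𝒮 k S.2)) fun x hx => ?_)
              exact mul_le_mul_right (ENNReal.rpow_le_rpow (laverage_le_famMax (h𝒮 k S.2) hx)
                (by norm_num)) _
    _ = _ := by
        rw [ENNReal.tsum_mul_left, ← lintegral_tsum fun k => ((hM2 k).pow_const _).aemeasurable]
        congr 1
        refine lintegral_congr fun x => ?_
        rw [← ENNReal.tsum_mul_right]
        refine tsum_congr fun k => ?_
        rw [ENNReal.rpow_two, mul_pow, hsq]

lemma lintegral_sparseSq_le [SFinite μ] (h : IsNestedFamily μ 𝒬) {γ : ℝ} (hγ : 0 < γ)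
    (h𝒮 : ∀ k, 𝒮 k ⊆ 𝒬) (hE : ∀ k, HasDisjointPortions μ γ (𝒮 k))
    (hφ : ∀ k, Measurable (φ k)) :
    ∫⁻ x, sparseSq μ 𝒮 φ x ∂μ
      ≤ (ENNReal.ofReal γ)⁻¹ * maxConst 2 * ∫⁻ x, ∑' k, φ k x ^ 2 ∂μ := by
  have := lintegral_sparseSq_mul_le h hγ h𝒮 hE hφ (measurable_const (a := (1 : ℝ≥0∞)))
  simp only [mul_one] at this
  refine this.trans ?_
  gcongr with x
  refine mul_le_of_le_one_right' (iSup₂_le fun Q _ => indicator_apply_le' (fun _ => ?_) fun _ => zero_le)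
  rw [setLAverage_eq, setLIntegral_one]
  exact ENNReal.div_self_le_one

lemma lintegral_sparseSq_rpow_le_of_two_lt [SigmaFinite μ] (h : IsNestedFamily μ 𝒬) {γ : ℝ}
    (hγ : 0 < γ) (h𝒮 : ∀ k, 𝒮 k ⊆ 𝒬) (hE : ∀ k, HasDisjointPortions μ γ (𝒮 k))
    (hφ : ∀ k, Measurable (φ k)) {p : ℝ} (hp : 2 < p) :
    ∫⁻ x, sparseSq μ 𝒮 φ x ^ (p / 2) ∂μ
      ≤ ((ENNReal.ofReal γ)⁻¹ * maxConst 2 * maxConst (p / (p - 2)) ^ (1 - 2 / p)) ^ (p / 2)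
        * ∫⁻ x, (∑' k, φ k x ^ 2) ^ (p / 2) ∂μ := by
  have hp0 : 0 < p := by linarith
  have hp2 : 0 < p - 2 := by linarith
  have hθ0 : 0 < 2 / p := by positivity
  have hθ1 : 0 < 1 - 2 / p := by
    rw [sub_pos, div_lt_one hp0]
    exact hp
  have hq : 1 < p / (p - 2) := by
    rw [one_lt_div hp2]
    linarith
  have hGm := measurable_sparseSq (μ := μ) (φ := φ) h h𝒮
  have hFm : Measurable fun x => ∑' k, φ k x ^ 2 := Measurable.tsum fun k => (hφ k).pow_const _
  set K := (ENNReal.ofReal γ)⁻¹ * maxConst 2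
  set T := ∫⁻ x, (∑' k, φ k x ^ 2) ^ (p / 2) ∂μ
  -- the powers of `sparseSq` truncated at height `n` to a set of finite measure
  set B := spanningSets μ
  have hBm : ∀ n, MeasurableSet (B n) := measurableSet_spanningSets μ
  set I : ℕ → α → ℝ≥0∞ := fun n =>
    (B n).indicator fun x => min (sparseSq μ 𝒮 φ x) n ^ (p / 2) with hI
  have hIm : ∀ n, Measurable (I n) := fun n =>
    ((hGm.min measurable_const).pow_const _).indicator (hBm n)
  have hfin : ∀ n, ∫⁻ x, I n x ∂μ ≠ ∞ := fun n => by
    rw [hI, lintegral_indicator (hBm n)]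
    refine ne_top_of_le_ne_top ?_ (lintegral_mono (g := fun _ => (n : ℝ≥0∞) ^ (p / 2)) fun x => ?_)
    · rw [setLIntegral_const]
      exact ENNReal.mul_ne_top (ENNReal.rpow_ne_top_of_nonneg (by positivity) (by simp))
        (measure_spanningSets_lt_top μ n).ne
    · exact ENNReal.rpow_le_rpow (min_le_right _ _) (by positivity)
  have hbound : ∀ n, ∫⁻ x, I n x ∂μ
      ≤ (K * maxConst (p / (p - 2)) ^ (1 - 2 / p)) ^ (p / 2) * T := fun n => by
    set w : α → ℝ≥0∞ := fun x => I n x ^ (1 - 2 / p)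
    have hw : Measurable w := (hIm n).pow_const _
    have hIw : ∀ x, I n x ≤ sparseSq μ 𝒮 φ x * w x := fun x => by
      by_cases hx : x ∈ B n
      · have hpow : I n x ^ (2 / p) ≤ sparseSq μ 𝒮 φ x := by
          simp only [hI, indicator_of_mem hx]
          rw [← ENNReal.rpow_mul, div_mul_div_cancel₀ two_ne_zero, div_self hp0.ne',
            ENNReal.rpow_one]
          exact min_le_left _ _
        calc I n x = I n x ^ (2 / p) * I n x ^ (1 - 2 / p) := by
              rw [← ENNReal.rpow_add_of_nonneg _ _ hθ0.le hθ1.le]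
              simp
          _ ≤ _ := by gcongr
      · simp [hI, hx]
    have hMw : ∫⁻ x, famMax μ 𝒬 w x ^ (p / (p - 2)) ∂μ
        ≤ maxConst (p / (p - 2)) * ∫⁻ x, I n x ∂μ := by
      refine (h.lintegral_famMax_rpow_le hq hw).trans (le_of_eq ?_)
      congr 1
      refine lintegral_congr fun x => ?_
      rw [← ENNReal.rpow_mul]
      have : (1 - 2 / p) * (p / (p - 2)) = 1 := by field_simp
      rw [this, ENNReal.rpow_one]
    have hHolder : ∫⁻ x, (∑' k, φ k x ^ 2) * famMax μ 𝒬 w x ∂μ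
        ≤ T ^ (2 / p) * (∫⁻ x, famMax μ 𝒬 w x ^ (p / (p - 2)) ∂μ) ^ (1 - 2 / p) := by
      refine le_trans (le_of_eq ?_) (ENNReal.lintegral_mul_norm_pow_le
        (hFm.pow_const (p / 2)).aemeasurable
        ((h.measurable_famMax w).pow_const (p / (p - 2))).aemeasurable hθ0.le hθ1.le (by ring))
      refine lintegral_congr fun x => ?_
      rw [← ENNReal.rpow_mul, ← ENNReal.rpow_mul]
      have h1 : p / 2 * (2 / p) = 1 := by field_simp
      have h2 : p / (p - 2) * (1 - 2 / p) = 1 := by field_simp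
      rw [h1, h2, ENNReal.rpow_one, ENNReal.rpow_one]
    have hmain : ∫⁻ x, I n x ∂μ ≤ K * maxConst (p / (p - 2)) ^ (1 - 2 / p) * T ^ (2 / p)
        * (∫⁻ x, I n x ∂μ) ^ (1 - 2 / p) := by
      calc _ ≤ ∫⁻ x, sparseSq μ 𝒮 φ x * w x ∂μ := lintegral_mono hIw
        _ ≤ K * ∫⁻ x, (∑' k, φ k x ^ 2) * famMax μ 𝒬 w x ∂μ :=
            lintegral_sparseSq_mul_le h hγ h𝒮 hE hφ hw
        _ ≤ K * (T ^ (2 / p) * (maxConst (p / (p - 2)) * ∫⁻ x, I n x ∂μ) ^ (1 - 2 / p)) := by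
            grw [hHolder, hMw]
        _ = _ := by
            rw [ENNReal.mul_rpow_of_nonneg _ _ hθ1.le]
            ring
    rcases eq_or_ne (∫⁻ x, I n x ∂μ) 0 with h0 | h0
    · simp [h0]
    have hle : (∫⁻ x, I n x ∂μ) ^ (2 / p)
        ≤ K * maxConst (p / (p - 2)) ^ (1 - 2 / p) * T ^ (2 / p) := by
      refine (ENNReal.mul_le_mul_iff_left
        (ENNReal.rpow_pos (p := 1 - 2 / p) (pos_iff_ne_zero.2 h0) (hfin n)).ne'
        (ENNReal.rpow_ne_top_of_nonneg hθ1.le (hfin n))).1 ?_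
      rw [← ENNReal.rpow_add_of_nonneg _ _ hθ0.le hθ1.le]
      simpa using hmain
    have hpp : 2 / p * (p / 2) = 1 := by field_simp
    calc _ = ((∫⁻ x, I n x ∂μ) ^ (2 / p)) ^ (p / 2) := by
          rw [← ENNReal.rpow_mul, hpp, ENNReal.rpow_one]
      _ ≤ (K * maxConst (p / (p - 2)) ^ (1 - 2 / p) * T ^ (2 / p)) ^ (p / 2) := by gcongr
      _ = _ := by
          rw [ENNReal.mul_rpow_of_nonneg _ _ (by positivity), ← ENNReal.rpow_mul T, hpp,
            ENNReal.rpow_one]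
  have hmono : Monotone I := fun m n hmn x => by
    have hB : B m ⊆ B n := monotone_spanningSets μ hmn
    refine (indicator_le_indicator_of_subset hB (fun _ => zero_le) x).trans
      (indicator_le_indicator ?_)
    gcongr
  have hsup : ∀ x, sparseSq μ 𝒮 φ x ^ (p / 2) = ⨆ n, I n x := fun x => by
    have hp2' : 0 < p / 2 := by positivity
    refine le_antisymm ?_ (iSup_le fun n => indicator_apply_le' (fun _ => ?_) fun _ => zero_le)
    · obtain ⟨m, hm⟩ := mem_iUnion.1 ((iUnion_spanningSets μ).symm ▸ mem_univ x : x ∈ ⋃ n, B n)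
      have hlim : Filter.Tendsto (fun n : ℕ => min (sparseSq μ 𝒮 φ x) n ^ (p / 2)) Filter.atTop
          (nhds (sparseSq μ 𝒮 φ x ^ (p / 2))) := by
        have := (tendsto_const_nhds (x := sparseSq μ 𝒮 φ x)).min ENNReal.tendsto_nat_nhds_top
        rw [min_top_right] at this
        exact this.ennrpow_const _
      refine le_of_tendsto hlim (Filter.eventually_atTop.2 ⟨m, fun n hn => ?_⟩)
      refine le_trans (le_of_eq ?_) (le_iSup (fun n => I n x) n)
      have hxB : x ∈ B n := monotone_spanningSets μ hn hm
      simp only [hI, indicator_of_mem hxB]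
    · gcongr
      exact min_le_left _ _
  rw [lintegral_congr hsup, lintegral_iSup hIm hmono]
  exact iSup_le hbound

lemma lintegral_sparseSq_rpow_le_of_lt_two [SFinite μ] (h : IsNestedFamily μ 𝒬) {γ : ℝ}
    (hγ : 0 < γ) (h𝒮 : ∀ k, 𝒮 k ⊆ 𝒬) (hE : ∀ k, HasDisjointPortions μ γ (𝒮 k))
    (hφ : ∀ k, Measurable (φ k)) {p : ℝ} (hp1 : 1 < p) (hp : p < 2) :
    ∫⁻ x, sparseSq μ 𝒮 φ x ^ (p / 2) ∂μ
      ≤ ((ENNReal.ofReal γ)⁻¹ * maxConst p) ^ (p / 2) * maxConst p ^ (1 - p / 2)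
        * ∫⁻ x, (∑' k, φ k x ^ 2) ^ (p / 2) ∂μ := by
  have hp0 : 0 < p := by linarith
  have ha : 0 < 1 - p / 2 := by linarith
  have hb : 0 < p / 2 := by linarith
  have hFm : Measurable fun x => ∑' k, φ k x ^ 2 := Measurable.tsum fun k => (hφ k).pow_const _
  have hγ' : (ENNReal.ofReal γ)⁻¹ ≠ 0 := by simp
  have hγ'' : (ENNReal.ofReal γ)⁻¹ ≠ ∞ := by simpa using hγ
  set T := ∫⁻ x, (∑' k, φ k x ^ 2) ^ (p / 2) ∂μ with hT
  rcases eq_or_ne T ∞ with hTtop | hTtop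
  · rw [hTtop, ENNReal.mul_top]
    · exact le_top
    · have h1 := maxConst_ne_top p
      have h2 := maxConst_ne_zero hp1
      exact mul_ne_zero
        (ENNReal.rpow_pos (pos_iff_ne_zero.2 (mul_ne_zero hγ' h2)) (ENNReal.mul_ne_top hγ'' h1)).ne'
        (ENNReal.rpow_pos (pos_iff_ne_zero.2 h2) h1).ne'
  set F : α → ℝ≥0∞ := fun x => (∑' k, φ k x ^ 2) ^ (1 / 2 : ℝ) with hF
  have hFm' : Measurable F := hFm.pow_const _
  have hFp : ∀ x, F x ^ p = (∑' k, φ k x ^ 2) ^ (p / 2) := fun x => by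
    rw [hF, ← ENNReal.rpow_mul]
    ring_nf
  have hFsq : ∀ x, F x ^ (2 : ℝ) = ∑' k, φ k x ^ 2 := fun x => by
    rw [hF, ← ENNReal.rpow_mul]
    norm_num
  have hφF : ∀ k x, φ k x ≤ F x := fun k x => by
    rw [← ENNReal.rpow_le_rpow_iff (z := 2) two_pos, hFsq, ENNReal.rpow_two]
    exact ENNReal.le_tsum k
  have hFfin : ∀ᵐ x ∂μ, F x < ∞ := by
    have : ∀ᵐ x ∂μ, F x ^ p < ∞ := ae_lt_top (hFm'.pow_const _) (by simpa only [hFp] using hTtop)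
    filter_upwards [this] with x hx
    exact (ENNReal.rpow_lt_top_iff_of_pos hp0).1 hx
  set u := famMax μ 𝒬 F with hu
  have hum : Measurable u := h.measurable_famMax F
  have huT : ∫⁻ x, u x ^ p ∂μ ≤ maxConst p * T := by
    simpa only [hT, ← hFp] using h.lintegral_famMax_rpow_le hp1 hFm'
  have hufin : ∀ᵐ x ∂μ, u x < ∞ := by
    have : ∀ᵐ x ∂μ, u x ^ p < ∞ := ae_lt_top (hum.pow_const _)
      (ne_top_of_le_ne_top (ENNReal.mul_ne_top (maxConst_ne_top p) hTtop) huT)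
    filter_upwards [this] with x hx
    exact (ENNReal.rpow_lt_top_iff_of_pos hp0).1 hx
  have hGzero : ∀ x, u x = 0 → sparseSq μ 𝒮 φ x = 0 := fun x hx => by
    simp only [sparseSq, ENNReal.tsum_eq_zero]
    intro k S
    by_cases hxS : x ∈ (S : Set α)
    · have h1 : ⨍⁻ y in (S : Set α), φ k y ∂μ ≤ u x :=
        (lintegral_mono fun y => hφF k y).trans (laverage_le_famMax (h𝒮 k S.2) hxS)
      rw [hx, nonpos_iff_eq_zero] at h1
      simp [h1]
    · simp [hxS]
  -- Hölder's inequality on a cube, with `φ_k = (g_k)^{p/2} F^{1-p/2}`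
  set g : ℕ → α → ℝ≥0∞ := fun k x => (φ k x ^ 2 * F x ^ (p - 2)) ^ (1 / p) with hg
  have hgm : ∀ k, Measurable (g k) := fun k =>
    (((hφ k).pow_const _).mul (hFm'.pow_const _)).pow_const _
  have hgp : ∀ k x, g k x ^ p = φ k x ^ 2 * F x ^ (p - 2) := fun k x => by
    rw [hg, ← ENNReal.rpow_mul, one_div_mul_cancel hp0.ne', ENNReal.rpow_one]
  have hφg : ∀ k, ∀ᵐ x ∂μ, φ k x ≤ g k x ^ (p / 2) * F x ^ (1 - p / 2) := fun k => by
    filter_upwards [hFfin] with x hx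
    rcases eq_or_ne (F x) 0 with h0 | h0
    · exact (hφF k x).trans (by simp [h0])
    refine le_of_eq ?_
    have h2 : g k x ^ (p / 2) = φ k x * F x ^ (p / 2 - 1) := by
      rw [div_eq_mul_one_div p 2, ENNReal.rpow_mul, hgp,
        ENNReal.mul_rpow_of_nonneg _ _ (by norm_num), ← ENNReal.rpow_mul, ← ENNReal.rpow_natCast,
        ← ENNReal.rpow_mul]
      norm_num
      ring_nf
    rw [h2, mul_assoc, ← ENNReal.rpow_add _ _ h0 hx.ne]
    ring_nf
    simp
  have hcube : ∀ k (S : 𝒮 k), (⨍⁻ y in (S : Set α), φ k y ∂μ) ^ 2 * ∫⁻ x in S, u x ^ (p - 2) ∂μ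
      ≤ (⨍⁻ y in (S : Set α), g k y ∂μ) ^ p * μ S := fun k S => by
    set X := ⨍⁻ y in (S : Set α), F y ∂μ with hX
    set Y := ⨍⁻ y in (S : Set α), g k y ∂μ with hY
    have h1 : ⨍⁻ y in (S : Set α), φ k y ∂μ ≤ Y ^ (p / 2) * X ^ (1 - p / 2) := by
      calc _ ≤ ⨍⁻ y in (S : Set α), g k y ^ (p / 2) * F y ^ (1 - p / 2) ∂μ :=
            setLAverage_mono_ae _ (hφg k)
        _ ≤ _ := ENNReal.lintegral_mul_norm_pow_le (hgm k).aemeasurable hFm'.aemeasurable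
            hb.le ha.le (by ring)
    have h2 : ∫⁻ x in S, u x ^ (p - 2) ∂μ ≤ X ^ (p - 2) * μ S := by
      rw [← setLIntegral_const]
      refine setLIntegral_mono' (h.measurableSet S (h𝒮 k S.2)) fun x hx => ?_
      rw [← neg_sub, ENNReal.rpow_neg, ENNReal.rpow_neg, ENNReal.inv_le_inv]
      exact ENNReal.rpow_le_rpow (laverage_le_famMax (h𝒮 k S.2) hx) (by linarith)
    have h3 : X ^ (2 - p) * X ^ (p - 2) ≤ 1 := by
      rw [← neg_sub 2 p, ENNReal.rpow_neg]
      exact ENNReal.mul_inv_le_one _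
    calc _ ≤ (Y ^ (p / 2) * X ^ (1 - p / 2)) ^ 2 * (X ^ (p - 2) * μ S) := by gcongr
      _ = Y ^ p * (X ^ (2 - p) * X ^ (p - 2)) * μ S := by
          rw [mul_pow, ← ENNReal.rpow_natCast, ← ENNReal.rpow_natCast, ← ENNReal.rpow_mul,
            ← ENNReal.rpow_mul]
          have e1 : p / 2 * ((2 : ℕ) : ℝ) = p := by norm_num
          have e2 : (1 - p / 2) * ((2 : ℕ) : ℝ) = 2 - p := by norm_num; ring
          rw [e1, e2]
          ring
      _ ≤ _ := by
          grw [h3]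
          simp
  have hweighted : ∫⁻ x, sparseSq μ 𝒮 φ x * u x ^ (p - 2) ∂μ
      ≤ (ENNReal.ofReal γ)⁻¹ * maxConst p * T := by
    rw [lintegral_sparseSq_mul h h𝒮 (hum.pow_const _)]
    calc _ ≤ ∑' k, (ENNReal.ofReal γ)⁻¹ * maxConst p * ∫⁻ x, g k x ^ p ∂μ :=
          ENNReal.tsum_le_tsum fun k => le_trans (ENNReal.tsum_le_tsum fun S => hcube k S)
            ((hE k).tsum_laverage_rpow_mul_measure_le h hγ (h𝒮 k) hp1 (hgm k))
      _ = (ENNReal.ofReal γ)⁻¹ * maxConst p * ∫⁻ x, F x ^ (2 : ℝ) * F x ^ (p - 2) ∂μ := by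
          rw [ENNReal.tsum_mul_left, ← lintegral_tsum fun k => ((hgm k).pow_const _).aemeasurable]
          congr 1
          refine lintegral_congr fun x => ?_
          rw [hFsq, ← ENNReal.tsum_mul_right]
          exact tsum_congr fun k => hgp k x
      _ ≤ _ := by
          rw [hT]
          gcongr with x
          rw [← hFp]
          rcases eq_or_ne (F x) 0 with h0 | h0
          · simp [h0]
          rcases eq_or_ne (F x) ∞ with h1 | h1
          · simp [h1, hp0]
          rw [← ENNReal.rpow_add _ _ h0 h1]
          ring_nf
          rfl
  have hpoint : ∀ᵐ x ∂μ, sparseSq μ 𝒮 φ x ^ (p / 2)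
      ≤ (sparseSq μ 𝒮 φ x * u x ^ (p - 2)) ^ (p / 2) * (u x ^ p) ^ (1 - p / 2) := by
    filter_upwards [hufin] with x hx
    rcases eq_or_ne (u x) 0 with h0 | h0
    · simp [hGzero x h0, hb]
    refine le_of_eq ?_
    rw [ENNReal.mul_rpow_of_nonneg _ _ hb.le, mul_assoc, ← ENNReal.rpow_mul, ← ENNReal.rpow_mul,
      ← ENNReal.rpow_add _ _ h0 hx.ne]
    ring_nf
    simp
  calc _ ≤ ∫⁻ x, (sparseSq μ 𝒮 φ x * u x ^ (p - 2)) ^ (p / 2) * (u x ^ p) ^ (1 - p / 2) ∂μ :=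
        lintegral_mono_ae hpoint
    _ ≤ (∫⁻ x, sparseSq μ 𝒮 φ x * u x ^ (p - 2) ∂μ) ^ (p / 2)
        * (∫⁻ x, u x ^ p ∂μ) ^ (1 - p / 2) :=
        ENNReal.lintegral_mul_norm_pow_le
          ((measurable_sparseSq h h𝒮).mul (hum.pow_const _)).aemeasurable
          (hum.pow_const _).aemeasurable hb.le ha.le (by ring)
    _ ≤ ((ENNReal.ofReal γ)⁻¹ * maxConst p * T) ^ (p / 2) * (maxConst p * T) ^ (1 - p / 2) := by
        gcongr
    _ = ((ENNReal.ofReal γ)⁻¹ * maxConst p) ^ (p / 2) * maxConst p ^ (1 - p / 2)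
        * (T ^ (p / 2) * T ^ (1 - p / 2)) := by
        rw [ENNReal.mul_rpow_of_nonneg _ T hb.le, ENNReal.mul_rpow_of_nonneg _ T ha.le]
        ring
    _ = _ := by
        rw [← ENNReal.rpow_add_of_nonneg _ _ hb.le ha.le]
        simp

end SparseSquareFunction

namespace DyadicLattice

variable {N : ℕ}

lemma exists_mem_gen_superset (D : DyadicLattice N) {k : ℤ} {Q : Set (EucN N)} (n : ℕ)
    (hQ : Q ∈ D.gen (k + n)) : ∃ R ∈ D.gen k, Q ⊆ R := by
  induction n generalizing Q with
  | zero => exact ⟨Q, by simpa using hQ, subset_rfl⟩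
  | succ n ih =>
    obtain ⟨R, hR, hQR⟩ := D.nested (k + n) Q (by simpa [add_assoc] using hQ)
    obtain ⟨R', hR', hRR'⟩ := ih hR
    exact ⟨R', hR', hQR.trans hRR'⟩

lemma subset_or_disjoint (D : DyadicLattice N) {j k : ℤ} (hjk : j ≤ k) {Q R : Set (EucN N)}
    (hQ : Q ∈ D.gen k) (hR : R ∈ D.gen j) : Q ⊆ R ∨ Disjoint Q R := by
  obtain ⟨n, rfl⟩ := Int.le.dest hjk
  obtain ⟨R', hR', hQR'⟩ := D.exists_mem_gen_superset n hQ
  rcases eq_or_ne R' R with rfl | hne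
  · exact .inl hQR'
  · exact .inr ((D.pairwiseDisjoint j hR' hR hne).mono_left hQR')

end DyadicLattice

lemma dyCube_eq_pi_s14 (N : ℕ) (k : ℤ) (x : EucN N) :
    dyCube N k x = univ.pi fun i => Ico (x i) (x i + (2 : ℝ) ^ (-k)) := by
  ext y
  simp [dyCube]

lemma DyadicLattice.isNestedFamily_cubes {N : ℕ} (D : DyadicLattice N) (σ : Measure (EucN N))
    [IsLocallyFiniteMeasure σ] : IsNestedFamily σ D.cubes where
  countable := by
    refine countable_iUnion fun k => (D.pairwiseDisjoint k).countable_of_nonempty_interior ?_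
    intro Q hQ
    obtain ⟨x, rfl⟩ := D.cube_form k Q hQ
    have h2 : (0 : ℝ) < 2 ^ (-k) := by positivity
    rw [id, dyCube_eq_pi_s14, interior_pi_set finite_univ]
    refine univ_pi_nonempty_iff.2 fun i => ?_
    rw [interior_Ico]
    exact nonempty_Ioo.2 (by linarith)
  measurableSet Q hQ := by
    obtain ⟨k, hQ⟩ := mem_iUnion.1 hQ
    obtain ⟨x, rfl⟩ := D.cube_form k Q hQ
    rw [dyCube_eq_pi_s14]
    exact MeasurableSet.univ_pi fun i => measurableSet_Ico
  measure_ne_top Q hQ := by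
    obtain ⟨k, hQ⟩ := mem_iUnion.1 hQ
    obtain ⟨x, rfl⟩ := D.cube_form k Q hQ
    rw [dyCube_eq_pi_s14]
    refine ne_top_of_le_ne_top ?_ (measure_mono (pi_mono fun i _ => Ico_subset_Icc_self))
    exact (isCompact_univ_pi fun i => isCompact_Icc).measure_lt_top.ne
  nested Q hQ R hR := by
    obtain ⟨k, hQ⟩ := mem_iUnion.1 hQ
    obtain ⟨j, hR⟩ := mem_iUnion.1 hR
    rcases le_total j k with hjk | hkj
    · rcases D.subset_or_disjoint hjk hQ hR with h | h
      · exact .inl h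
      · exact .inr (.inr h)
    · rcases D.subset_or_disjoint hkj hR hQ with h | h
      · exact .inr (.inl h)
      · exact .inr (.inr h.symm)

lemma enorm_avgM_le {N : ℕ} (σ : Measure (EucN N)) {Q : Set (EucN N)} (hQ : σ Q ≠ ∞)
    (f : EucN N → ℝ) : ‖avgM σ Q f‖ₑ ≤ ⨍⁻ y in Q, ‖f y‖ₑ ∂σ := by
  rcases eq_or_ne (σ Q) 0 with h0 | h0
  · simp [avgM, h0]
  · rw [avgM, setLAverage_eq, div_eq_mul_inv, enorm_mul, enorm_inv (ENNReal.toReal_ne_zero.2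
      ⟨h0, hQ⟩), ← div_eq_mul_inv, Real.enorm_of_nonneg ENNReal.toReal_nonneg,
      ENNReal.ofReal_toReal hQ]
    gcongr
    exact enorm_integral_le_lintegral_enorm _

lemma exists_lintegral_sparseSq_rpow_le (p γ : ℝ) (hp : 1 < p) (hγ : 0 < γ) :
    ∃ C : ℝ≥0∞, C ≠ ∞ ∧ ∀ {α : Type} [MeasurableSpace α] (μ : Measure α) [SigmaFinite μ]
      (𝒬 : Set (Set α)) (𝒮 : ℕ → Set (Set α)) (φ : ℕ → α → ℝ≥0∞), IsNestedFamily μ 𝒬 →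
      (∀ k, 𝒮 k ⊆ 𝒬) → (∀ k, HasDisjointPortions μ γ (𝒮 k)) → (∀ k, Measurable (φ k)) →
      ∫⁻ x, sparseSq μ 𝒮 φ x ^ (p / 2) ∂μ ≤ C * ∫⁻ x, (∑' k, φ k x ^ 2) ^ (p / 2) ∂μ := by
  have hK : ∀ s, (ENNReal.ofReal γ)⁻¹ * maxConst s ≠ ∞ := fun s =>
    ENNReal.mul_ne_top (by simpa using hγ) (maxConst_ne_top s)
  rcases lt_trichotomy p 2 with h2 | rfl | h2
  · refine ⟨_, ?_, fun μ _ 𝒬 𝒮 φ h h𝒮 hE hφ =>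
      lintegral_sparseSq_rpow_le_of_lt_two h hγ h𝒮 hE hφ hp h2⟩
    exact ENNReal.mul_ne_top (ENNReal.rpow_ne_top_of_nonneg (by linarith) (hK p))
      (ENNReal.rpow_ne_top_of_nonneg (by linarith) (maxConst_ne_top p))
  · refine ⟨_, hK 2, fun μ _ 𝒬 𝒮 φ h h𝒮 hE hφ => ?_⟩
    simpa using lintegral_sparseSq_le h hγ h𝒮 hE hφ
  · refine ⟨_, ?_, fun μ _ 𝒬 𝒮 φ h h𝒮 hE hφ =>
      lintegral_sparseSq_rpow_le_of_two_lt h hγ h𝒮 hE hφ h2⟩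
    have : 2 / p < 1 := (div_lt_one (by linarith)).2 h2
    exact ENNReal.rpow_ne_top_of_nonneg (by linarith) (ENNReal.mul_ne_top (hK 2)
      (ENNReal.rpow_ne_top_of_nonneg (by linarith) (maxConst_ne_top _)))

/-- **vector-valued Carleson embedding theorem.** For `γ`-sparse collections
`𝒮_k` and `(f_k)_{k} ⊆ L^p(σ;ℓ²)`,
`‖(∑_k ∑_{S∈𝒮_k} (⟨f_k⟩^σ_S)² 1_S)^{1/2}‖_{L^p(σ)} ≤ C(γ,p) ‖(∑_k f_k²)^{1/2}‖_{L^p(σ)}`. -/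
theorem vector_valued_carleson_embedding (p γ : ℝ) (hp : 1 < p) (hγ0 : 0 < γ) (hγ1 : γ < 1) :
    ∃ C : ℝ≥0∞, C ≠ ∞ ∧
      ∀ (N : ℕ), 1 ≤ N →
      ∀ (D : DyadicLattice N) (σ : Measure (EucN N)), IsLocallyFiniteMeasure σ →
      ∀ 𝒮 : ℕ → Set (Set (EucN N)), (∀ k, IsSparse D σ γ (𝒮 k)) →
      ∀ f : ℕ → EucN N → ℝ, (∀ k, Measurable (f k)) →
        (∫⁻ x, (∑' (k : ℕ) (S : 𝒮 k),
              (‖avgM σ (S : Set (EucN N)) (f k)‖₊ : ℝ≥0∞) ^ 2 * indE (S : Set (EucN N)) x)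
            ^ (p / 2) ∂σ) ^ (1 / p)
          ≤ C * (∫⁻ x, (∑' k : ℕ, (‖f k x‖₊ : ℝ≥0∞) ^ 2) ^ (p / 2) ∂σ) ^ (1 / p) := by
  obtain ⟨C, hC, hmain⟩ := exists_lintegral_sparseSq_rpow_le p γ hp hγ0
  have hp0 : 0 < p := by linarith
  refine ⟨C ^ (1 / p), ENNReal.rpow_ne_top_of_nonneg (by positivity) hC, ?_⟩
  intro N _ D σ _ 𝒮 h𝒮 f hf
  have hD := D.isNestedFamily_cubes σ
  rw [← ENNReal.mul_rpow_of_nonneg _ _ (by positivity)]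
  gcongr ?_ ^ (1 / p)
  refine le_trans (lintegral_mono fun x => ?_) (hmain σ D.cubes 𝒮 (fun k x => ‖f k x‖ₑ) hD
    (fun k => (h𝒮 k).1) (fun k => (h𝒮 k).2) (fun k => (hf k).enorm))
  refine ENNReal.rpow_le_rpow ?_ (by positivity)
  refine ENNReal.tsum_le_tsum fun k => ENNReal.tsum_le_tsum fun S => ?_
  exact mul_le_mul_left (pow_le_pow_left' (enorm_avgM_le σ
    (hD.measure_ne_top S ((h𝒮 k).1 S.2)) (f k)) 2) _

end
end
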